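/- arXiv:2104.12172 — 3 statements merged into one kernel-verified Lean document; each statement's English description precedes it below -/
import Mathlib

section
/- For all integers m and n with 5 ≤ m < n, every convex n-gon contains a convex m-gon whose vertices are m of the n-gon's vertices and whose area is at least m/n times the area of the n-gon. (That is, f_n(m) ≥ m/n.) -/
open MeasureTheory

/-- The area of a planar point set: the Lebesgue measure of its convex hull. -/
noncomputable def area (S : Set (ℝ × ℝ)) : ℝ :=
  (volume (convexHull ℝ S)).toReal

/-- Points in strictly convex position, affinely spanning the plane. -/
def StrictConvexPos {n : ℕ} (p : Fin n → ℝ × ℝ) : Prop :=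
  (∀ i : Fin n, p i ∉ convexHull ℝ (p '' {j | j ≠ i})) ∧
    affineSpan ℝ (Set.range p) = ⊤

/-- The cross product of two plane vectors. -/
def cross (u v : ℝ × ℝ) : ℝ := u.1 * v.2 - u.2 * v.1

/-- Twice the signed area of the triangle `a b c`. -/
def orient (a b c : ℝ × ℝ) : ℝ := cross (b - a) (c - a)

lemma orient_eq (a b c : ℝ × ℝ) :
    orient a b c = (b.1 - a.1) * (c.2 - a.2) - (b.2 - a.2) * (c.1 - a.1) := rfl

lemma orient_rotate (a b c : ℝ × ℝ) : orient b c a = orient a b c := by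
  simp only [orient_eq]; ring

/-- An `n`-periodic sequence listing the vertices of a strictly convex `n`-gon counterclockwise. -/
structure CyclicConvex (n : ℕ) (q : ℕ → ℝ × ℝ) : Prop where
  periodic : ∀ i, q (i + n) = q i
  pos : ∀ i j k, i < j → j < k → k < i + n → 0 < orient (q i) (q j) (q k)

/-- Twice the signed area enclosed by an `n`-periodic sequence of points. -/
def shoelace (n : ℕ) (q : ℕ → ℝ × ℝ) : ℝ :=
  ∑ i ∈ Finset.range n, cross (q i) (q (i + 1))

namespace CyclicConvex

lemma shift {n : ℕ} {q : ℕ → ℝ × ℝ} (h : CyclicConvex n q) (s : ℕ) :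
    CyclicConvex n (fun i => q (i + s)) where
  periodic i := by
    have := h.periodic (i + s)
    rwa [Nat.add_right_comm] at this
  pos i j k hij hjk hk := h.pos _ _ _ (by omega) (by omega) (by omega)

lemma shoelace_shift {n : ℕ} {q : ℕ → ℝ × ℝ} (h : CyclicConvex n q) (s : ℕ) :
    shoelace n (fun i => q (i + s)) = shoelace n q := by
  induction s with
  | zero => rfl
  | succ s ih =>
    rw [← ih]
    have h1 := Finset.sum_range_succ (fun i => cross (q (i + s)) (q (i + 1 + s))) n
    have h2 := Finset.sum_range_succ' (fun i => cross (q (i + s)) (q (i + 1 + s))) n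
    have e1 : q (n + s) = q (0 + s) := by rw [add_comm n, h.periodic, zero_add]
    have e2 : q (n + 1 + s) = q (0 + 1 + s) := by
      rw [show n + 1 + s = (0 + 1 + s) + n by omega, h.periodic]
    rw [e1, e2, h2] at h1
    have h3 := add_right_cancel h1
    simp only [shoelace]
    rw [← h3]
    refine Finset.sum_congr rfl fun i _ => ?_
    rw [show i + (s + 1) = i + 1 + s by omega, show i + 1 + (s + 1) = i + 1 + 1 + s by omega]

/-- Strict convexity of finitely many points listed counterclockwise gives a cyclically convex
periodic extension. -/
lemma of_lt {n : ℕ} (hn : 0 < n) {q : ℕ → ℝ × ℝ}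
    (h : ∀ i j k, i < j → j < k → k < n → 0 < orient (q i) (q j) (q k)) :
    CyclicConvex n (fun i => q (i % n)) where
  periodic i := by simp
  pos i j k hij hjk hk := by
    have hi := Nat.mod_lt i hn
    have hd := Nat.div_add_mod i n
    set r := i % n
    set a := n * (i / n) with ha
    have key : ∀ x, a ≤ x → (x < a + n → x % n = x - a) ∧
        (a + n ≤ x → x < a + n + n → x % n = x - a - n) := by
      intro x hx
      have hxa : x % n = (x - a) % n := by
        conv_lhs => rw [← Nat.sub_add_cancel hx, ha, Nat.add_mul_mod_self_left]
      refine ⟨fun h1 => ?_, fun h1 h2 => ?_⟩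
      · rw [hxa, Nat.mod_eq_of_lt (by omega)]
      · rw [hxa, Nat.mod_eq_sub_mod (by omega), Nat.mod_eq_of_lt (by omega)]
    obtain ⟨j1, j2⟩ := key j (by omega)
    obtain ⟨k1, k2⟩ := key k (by omega)
    rcases lt_or_ge k (a + n) with hkn | hkn
    · rw [j1 (by omega), k1 hkn]
      exact h _ _ _ (by omega) (by omega) (by omega)
    · rw [k2 hkn (by omega)]
      rcases lt_or_ge j (a + n) with hjn | hjn
      · rw [j1 hjn, ← orient_rotate, ← orient_rotate]
        exact h _ _ _ (by omega) (by omega) (by omega)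
      · rw [j2 hjn (by omega), ← orient_rotate]
        exact h _ _ _ (by omega) (by omega) (by omega)

/-- Deleting the last vertex of a convex `(n + 1)`-gon. -/
lemma deleteLast {n : ℕ} (hn : 0 < n) {q : ℕ → ℝ × ℝ} (h : CyclicConvex (n + 1) q) :
    CyclicConvex n (fun i => q (i % n)) :=
  of_lt hn fun i j k hij hjk hk => h.pos i j k hij hjk (by omega)

lemma shoelace_deleteLast {n : ℕ} {q : ℕ → ℝ × ℝ} (h : CyclicConvex (n + 2) q) :
    shoelace (n + 1) (fun i => q (i % (n + 1))) + orient (q n) (q (n + 1)) (q (n + 2)) =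
      shoelace (n + 2) q := by
  have h0 : q (n + 2) = q 0 := by simpa using h.periodic 0
  have hs : ∑ i ∈ Finset.range n, cross (q (i % (n + 1))) (q ((i + 1) % (n + 1))) =
      ∑ i ∈ Finset.range n, cross (q i) (q (i + 1)) := by
    refine Finset.sum_congr rfl fun i hi => ?_
    have := Finset.mem_range.1 hi
    rw [Nat.mod_eq_of_lt (by omega), Nat.mod_eq_of_lt (by omega)]
  simp only [shoelace, Finset.sum_range_succ, hs, Nat.mod_self, h0,
    Nat.mod_eq_of_lt (Nat.lt_succ_self n)]
  simp only [orient, cross, Prod.fst_sub, Prod.snd_sub]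
  ring

end CyclicConvex

/-- The diagonals of a convex quadrilateral intersect. -/
lemma exists_diagonal_inter {a b c d : ℝ × ℝ} (h₁ : 0 < orient a b c) (h₂ : 0 < orient a c d)
    (h₃ : 0 < orient a b d) (h₄ : 0 < orient b c d) :
    ∃ s t : ℝ, 0 ≤ s ∧ s ≤ 1 ∧ 0 ≤ t ∧ t ≤ 1 ∧
      a.1 + s * (c.1 - a.1) = b.1 + t * (d.1 - b.1) ∧
      a.2 + s * (c.2 - a.2) = b.2 + t * (d.2 - b.2) := by
  have hst : orient a b d + orient b c d = orient a b c + orient a c d := by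
    simp only [orient_eq]; ring
  have hpos : 0 < orient a b c + orient a c d := by positivity
  refine ⟨orient a b d / (orient a b c + orient a c d),
    orient a b c / (orient a b c + orient a c d), by positivity,
    (div_le_one hpos).2 (by linarith), by positivity, (div_le_one hpos).2 (by linarith), ?_, ?_⟩
  all_goals
    field_simp
    simp only [orient_eq]
    ring

lemma mul_nonneg_of_mul_eq {a b x y : ℝ} (hx : 0 < x) (hy : 0 < y) (h : a * x = b * y) :
    0 ≤ a * b := by
  have h' : a * b * x = b ^ 2 * y := by linear_combination b * h
  exact nonneg_of_mul_nonneg_left (h' ▸ by positivity) hx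

/-- A convex hexagon has an ear of at most one sixth of its area. -/
lemma six_mul_le_of_le_ears {A B C D E F : ℝ × ℝ} {e : ℝ}
    (hABC : e ≤ orient A B C) (hBCD : e ≤ orient B C D) (hCDE : e ≤ orient C D E)
    (hDEF : e ≤ orient D E F) (hEFA : e ≤ orient E F A) (hFAB : e ≤ orient F A B)
    (h₁ : 0 < orient A B D) (h₂ : 0 < orient A B E) (h₃ : 0 < orient A C D)
    (h₄ : 0 < orient A C F) (h₅ : 0 < orient A D E) (h₆ : 0 < orient A D F)
    (h₇ : 0 < orient B C E) (h₈ : 0 < orient B C F) (h₉ : 0 < orient B D E)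
    (h₁₀ : 0 < orient B E F) (h₁₁ : 0 < orient C D F) (h₁₂ : 0 < orient C E F) :
    6 * e ≤ cross A B + cross B C + cross C D + cross D E + cross E F + cross F A := by
  obtain ⟨p, p', hp0, hp1, hp0', hp1', hpx, hpy⟩ := exists_diagonal_inter h₁ h₅ h₂ h₉
  obtain ⟨t, t', ht0, ht1, ht0', ht1', htx, hty⟩ := exists_diagonal_inter h₇ h₁₀ h₈ h₁₂
  obtain ⟨r, r', hr0, hr1, hr0', hr1', hrx, hry⟩ := exists_diagonal_inter h₃ h₆ h₄ h₁₁
  have mix : ∀ {x y s : ℝ}, 0 ≤ s → s ≤ 1 → e ≤ x → e ≤ y → e ≤ x + s * (y - x) := by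
    intro x y s h0 h1 hx hy
    nlinarith [mul_nonneg h0 (sub_nonneg.2 hy), mul_nonneg (sub_nonneg.2 h1) (sub_nonneg.2 hx)]
  have k₁ := mix hr0' hr1' hABC hFAB
  have k₂ := mix hr0 hr1 hABC hBCD
  have k₃ := mix ht0 ht1 hBCD hCDE
  have k₄ := mix ht0' ht1' hCDE hDEF
  have k₅ := mix hp0 hp1 hEFA hDEF
  have k₆ := mix hp0' hp1' hFAB hEFA
  set P : ℝ × ℝ := (A.1 + p * (D.1 - A.1), A.2 + p * (D.2 - A.2)) with hP
  set Q : ℝ × ℝ := (B.1 + t * (E.1 - B.1), B.2 + t * (E.2 - B.2)) with hQ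
  set R : ℝ × ℝ := (A.1 + r * (D.1 - A.1), A.2 + r * (D.2 - A.2)) with hR
  have hP' : P = (B.1 + p' * (E.1 - B.1), B.2 + p' * (E.2 - B.2)) := Prod.ext hpx hpy
  have hQ' : Q = (C.1 + t' * (F.1 - C.1), C.2 + t' * (F.2 - C.2)) := Prod.ext htx hty
  have hR' : R = (C.1 + r' * (F.1 - C.1), C.2 + r' * (F.2 - C.2)) := Prod.ext hrx hry
  have e₁ : orient A B C + r' * (orient F A B - orient A B C) = orient A B R := by
    rw [hR']; simp only [orient_eq]; ring
  have e₂ : orient A B C + r * (orient B C D - orient A B C) = orient B C R := by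
    rw [hR]; simp only [orient_eq]; ring
  have e₃ : orient B C D + t * (orient C D E - orient B C D) = orient C D Q := by
    rw [hQ]; simp only [orient_eq]; ring
  have e₄ : orient C D E + t' * (orient D E F - orient C D E) = orient D E Q := by
    rw [hQ']; simp only [orient_eq]; ring
  have e₅ : orient E F A + p * (orient D E F - orient E F A) = orient E F P := by
    rw [hP]; simp only [orient_eq]; ring
  have e₆ : orient F A B + p' * (orient E F A - orient F A B) = orient F A P := by
    rw [hP']; simp only [orient_eq]; ring
  rw [e₁] at k₁; rw [e₂] at k₂; rw [e₃] at k₃; rw [e₄] at k₄; rw [e₅] at k₅; rw [e₆] at k₆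
  have c₁ : orient P A R = 0 := by rw [hP, hR]; simp only [orient_eq]; ring
  have c₂ : orient R C Q = 0 := by rw [hR', hQ']; simp only [orient_eq]; ring
  have c₃ : orient Q E P = 0 := by rw [hQ, hP']; simp only [orient_eq]; ring
  have huv : 0 < cross (D - A) (E - B) := by
    have : cross (D - A) (E - B) = orient A B D + orient A D E := by
      simp only [orient_eq, cross, Prod.fst_sub, Prod.snd_sub]; ring
    linarith
  have huw : 0 < cross (D - A) (F - C) := by
    have : cross (D - A) (F - C) = orient A C D + orient A D F := by
      simp only [orient_eq, cross, Prod.fst_sub, Prod.snd_sub]; ring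
    linarith
  have hvw : 0 < cross (E - B) (F - C) := by
    have : cross (E - B) (F - C) = orient B C E + orient B E F := by
      simp only [orient_eq, cross, Prod.fst_sub, Prod.snd_sub]; ring
    linarith
  have hPRQ : orient P R Q = (r - p) * (t - p') * cross (D - A) (E - B) := by
    have a₁ : R - P = ((r - p) * (D.1 - A.1), (r - p) * (D.2 - A.2)) := by
      rw [hR, hP]; ext <;> simp <;> ring
    have a₂ : Q - P = ((t - p') * (E.1 - B.1), (t - p') * (E.2 - B.2)) := by
      rw [hQ, hP']; ext <;> simp <;> ring
    rw [orient, a₁, a₂]; simp only [cross, Prod.fst_sub, Prod.snd_sub]; ring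
  have hcross : (r - p) * cross (D - A) (F - C) = (t - p') * cross (E - B) (F - C) := by
    simp only [cross, Prod.fst_sub, Prod.snd_sub]
    linear_combination (F.2 - C.2) * (hrx - hpx - htx) - (F.1 - C.1) * (hry - hpy - hty)
  have hab := mul_nonneg_of_mul_eq huw hvw hcross
  have hnn : 0 ≤ orient P R Q := hPRQ ▸ mul_nonneg hab huv.le
  have hsum : cross A B + cross B C + cross C D + cross D E + cross E F + cross F A =
      orient A B R + orient B C R + orient C D Q + orient D E Q + orient E F P + orient F A P +
        (orient P A R + orient R C Q + orient Q E P + orient P R Q) := by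
    clear_value P Q R
    simp only [orient_eq, cross]; ring
  linarith

/-- If the values of an affine function vanishing at `u` do not decrease when passing from `z` to
either neighbour, the convex quadrilateral `x z w u` degenerates. -/
lemma not_valley {x z w u v : ℝ × ℝ} (h₁ : 0 < orient x z w) (h₂ : 0 < orient z w u)
    (h₃ : 0 < orient x z u) (hz : 0 < orient u v z) (hx : orient u v z ≤ orient u v x)
    (hw : orient u v z ≤ orient u v w) : False := by
  have h : orient z w u * orient u v x + orient x z u * orient u v w =
      (orient z w u + orient x z u - orient x z w) * orient u v z := by
    simp only [orient_eq]; ring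
  nlinarith [mul_le_mul_of_nonneg_left hx h₂.le, mul_le_mul_of_nonneg_left hw h₃.le,
    mul_pos h₁ hz]

/-- The edges of the polygon `q` on either side of the edge from `q (i + 1)` to `q (i + 2)` turn by
more than a half-turn. -/
def Converging (q : ℕ → ℝ × ℝ) (i : ℕ) : Prop :=
  cross (q (i + 1) - q i) (q (i + 3) - q (i + 2)) < 0

lemma cross_sub_eq_orient (u v x y : ℝ × ℝ) :
    cross (v - u) (y - x) = orient u v y - orient u v x := by
  simp only [orient, cross, Prod.fst_sub, Prod.snd_sub]; ring

lemma cross_swap (u v : ℝ × ℝ) : cross u v = -cross v u := by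
  simp only [cross]; ring

namespace CyclicConvex

lemma cross_pos_of_converging {n : ℕ} {q : ℕ → ℝ × ℝ} (h : CyclicConvex n q) {i k : ℕ}
    (hi : Converging q i) (hk : i + 3 ≤ k) (hk' : k ≤ i + n) :
    0 < cross (q (i + 3) - q (i + 2)) (q (k + 1) - q k) := by
  have hi' : 0 < cross (q (i + 3) - q (i + 2)) (q (i + 1) - q i) := by
    rw [cross_swap]; exact neg_pos.2 hi
  rw [← h.periodic i, ← h.periodic (i + 1)] at hi'
  rcases hk'.eq_or_lt with rfl | hk'
  · rwa [show i + n + 1 = i + 1 + n by omega]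
  by_contra! hneg
  rw [cross_sub_eq_orient] at hi' hneg
  have hu := h.periodic (i + 2)
  have hpos : ∀ j, i + 3 < j → j < i + 2 + n → 0 < orient (q (i + 2)) (q (i + 3)) (q j) :=
    fun j h₁ h₂ => h.pos _ _ _ (by omega) h₁ h₂
  have hedge : ∀ a b, i + 3 ≤ a → a < b → b < i + 2 + n → 0 < orient (q a) (q b) (q (i + 2)) := by
    intro a b h₁ h₂ h₃
    rw [← hu]
    exact h.pos _ _ _ h₂ h₃ (by omega)
  have valley : ∀ a b, i + 3 ≤ a → a < b → b < i + 1 + n →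
      orient (q (i + 2)) (q (i + 3)) (q b) ≤ orient (q (i + 2)) (q (i + 3)) (q a) →
      orient (q (i + 2)) (q (i + 3)) (q b) ≤ orient (q (i + 2)) (q (i + 3)) (q (i + 1 + n)) →
      False := fun a b h₁ h₂ h₃ =>
    not_valley (h.pos _ _ _ h₂ h₃ (by omega)) (hedge _ _ (by omega) h₃ (by omega))
      (hedge _ _ h₁ h₂ (by omega)) (hpos _ (by omega) (by omega))
  rcases eq_or_ne (k + 1) (i + n) with hkn | hkn
  · exact valley k (k + 1) hk (by omega) (by omega) (by linarith) (by rw [hkn]; linarith)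
  rcases le_total (orient (q (i + 2)) (q (i + 3)) (q (k + 1)))
    (orient (q (i + 2)) (q (i + 3)) (q (i + 1 + n))) with hle | hle
  · exact valley k (k + 1) hk (by omega) (by omega) (by linarith) hle
  · exact valley (k + 1) (i + n) (by omega) (by omega) (by omega) (by linarith) (by linarith)

lemma not_converging_pair {n : ℕ} {q : ℕ → ℝ × ℝ} (h : CyclicConvex n q) {i j : ℕ}
    (hij : i + 2 ≤ j) (hji : j + 2 ≤ i + n) (hi : Converging q i) (hj : Converging q j) :
    False := by
  have h₁ := h.cross_pos_of_converging hi (k := j + 2) (by omega) hji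
  have h₂ := h.cross_pos_of_converging hj (k := i + n + 2) (by omega) (by omega)
  rw [show i + n + 2 + 1 = i + 3 + n by omega, show i + n + 2 = i + 2 + n by omega, h.periodic,
    h.periodic, cross_swap] at h₂
  linarith

lemma exists_not_converging {n : ℕ} (hn : 6 ≤ n) {q : ℕ → ℝ × ℝ} (h : CyclicConvex n q) :
    ∃ v, ¬ Converging q v ∧ ¬ Converging q (v + 1) := by
  by_contra! H
  rcases Classical.em (Converging q 0) with h₀ | h₀ <;>
    rcases Classical.em (Converging q 3) with h₃ | h₃
  · exact h.not_converging_pair (by omega) (by omega) h₀ h₃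
  · exact h.not_converging_pair (by omega) (by omega) h₀ (H 3 h₃)
  · exact h.not_converging_pair (by omega) (by omega) (H 0 h₀) h₃
  · exact h.not_converging_pair (by omega) (by omega) (H 0 h₀) (H 3 h₃)

/-- Deleting a suitable vertex of a convex polygon does not create smaller ears. -/
lemma exists_ear_le_of_deleteLast {n : ℕ} {r : ℕ → ℝ × ℝ} (hr : CyclicConvex (n + 3) r)
    (g₁ : 0 ≤ cross (r (n + 1) - r n) (r 0 - r (n + 2)))
    (g₂ : 0 ≤ cross (r (n + 2) - r (n + 1)) (r 1 - r 0)) (j : ℕ) :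
    ∃ l, orient (r l) (r (l + 1)) (r (l + 2)) ≤
      orient (r (j % (n + 2))) (r ((j + 1) % (n + 2))) (r ((j + 2) % (n + 2))) := by
  have hj := Nat.mod_lt j (show 0 < n + 2 by omega)
  rw [← Nat.mod_add_mod j, ← Nat.mod_add_mod j (n + 2) 2]
  generalize j % (n + 2) = i at hj ⊢
  have r0 : r (n + 3) = r 0 := by simpa using hr.periodic 0
  have r1 : r (n + 4) = r 1 := by
    rw [show n + 4 = 1 + (n + 3) by omega]; exact hr.periodic 1
  rcases lt_trichotomy i n with hin | rfl | hin
  · refine ⟨i, le_of_eq ?_⟩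
    rw [Nat.mod_eq_of_lt (show i + 1 < n + 2 by omega),
      Nat.mod_eq_of_lt (show i + 2 < n + 2 by omega)]
  · refine ⟨i, ?_⟩
    rw [Nat.mod_eq_of_lt (show i + 1 < i + 2 by omega), Nat.mod_self]
    rw [cross_sub_eq_orient] at g₁
    linarith
  · obtain rfl : i = n + 1 := by omega
    refine ⟨n + 2, ?_⟩
    have h₁ : (n + 1 + 2) % (n + 2) = 1 := by
      rw [show n + 1 + 2 = 1 + (n + 2) by omega, Nat.add_mod_right, Nat.mod_eq_of_lt (by omega)]
    rw [Nat.mod_self, h₁, r0, r1]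
    have : orient (r (n + 1)) (r 0) (r 1) - orient (r (n + 2)) (r 0) (r 1) =
        cross (r (n + 2) - r (n + 1)) (r 1 - r 0) := by
      simp only [orient, cross, Prod.fst_sub, Prod.snd_sub]; ring
    linarith

/-- A convex polygon with `n ≥ 6` vertices has an ear of at most `1 / n` of its area. -/
theorem exists_small_ear (n : ℕ) {q : ℕ → ℝ × ℝ} (h : CyclicConvex (n + 6) q) :
    ∃ j, ((n + 6 : ℕ) : ℝ) * orient (q j) (q (j + 1)) (q (j + 2)) ≤ shoelace (n + 6) q := by
  induction n generalizing q with
  | zero =>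
    obtain ⟨j, -, hj⟩ := Finset.exists_min_image (Finset.range 6)
      (fun j => orient (q j) (q (j + 1)) (q (j + 2))) ⟨0, by simp⟩
    refine ⟨j, ?_⟩
    have hj' := fun i hi => hj i (Finset.mem_range.2 hi)
    have q6 : q 6 = q 0 := h.periodic 0
    have q7 : q 7 = q 1 := h.periodic 1
    have h4 := hj' 4 (by omega)
    have h5 := hj' 5 (by omega)
    simp only [Nat.reduceAdd, q6, q7] at h4 h5
    have hp : ∀ i j k, i < j → j < k → k < 6 → 0 < orient (q i) (q j) (q k) :=
      fun i j k h₁ h₂ h₃ => h.pos i j k h₁ h₂ (by omega)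
    have := six_mul_le_of_le_ears (hj' 0 (by omega)) (hj' 1 (by omega)) (hj' 2 (by omega))
      (hj' 3 (by omega)) h4 h5
    simp only [shoelace, Finset.sum_range_succ, Finset.sum_range_zero, Nat.reduceAdd, q6]
    refine le_trans (le_of_eq (by norm_num)) ((this ?_ ?_ ?_ ?_ ?_ ?_ ?_ ?_ ?_ ?_ ?_ ?_).trans
      (le_of_eq (by ring)))
    all_goals exact hp _ _ _ (by norm_num) (by norm_num) (by norm_num)
  | succ n ih =>
    obtain ⟨v, hv₁, hv₂⟩ := h.exists_not_converging (by omega)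
    set r : ℕ → ℝ × ℝ := fun i => q (i + (v + 3)) with hrdef
    have hr : CyclicConvex (n + 4 + 3) r := h.shift (v + 3)
    have hS : shoelace (n + 4 + 3) r = shoelace (n + 1 + 6) q := h.shoelace_shift (v + 3)
    have hr0 : ∀ l, r (n + 4 + l) = q (v + l) := fun l => by
      rw [← h.periodic (v + l)]; simp only [hrdef]; congr 1; omega
    have g₁ : 0 ≤ cross (r (n + 4 + 1) - r (n + 4)) (r 0 - r (n + 4 + 2)) := by
      rw [hr0, hr0, show r (n + 4) = q v from hr0 0]
      simpa [hrdef, Converging] using hv₁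
    have g₂ : 0 ≤ cross (r (n + 4 + 2) - r (n + 4 + 1)) (r 1 - r 0) := by
      rw [hr0, hr0]
      simpa [hrdef, Converging, add_comm, add_left_comm] using hv₂
    obtain ⟨j, hj⟩ := ih (CyclicConvex.deleteLast (by omega) hr)
    obtain ⟨l, hl⟩ := exists_ear_le_of_deleteLast hr g₁ g₂ j
    have hsub := hr.shoelace_deleteLast (n := n + 5)
    rw [hS] at hsub
    rcases le_or_gt (((n + 1 + 6 : ℕ) : ℝ) * orient (r (n + 5)) (r (n + 5 + 1)) (r (n + 5 + 2)))
      (shoelace (n + 1 + 6) q) with hle | hlt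
    · exact ⟨n + 5 + (v + 3), by
        rwa [add_right_comm _ (v + 3) 1, add_right_comm _ (v + 3) 2]⟩
    · refine ⟨l + (v + 3), ?_⟩
      have hl' : orient (q (l + (v + 3))) (q (l + (v + 3) + 1)) (q (l + (v + 3) + 2)) =
          orient (r l) (r (l + 1)) (r (l + 2)) := by
        simp only [hrdef]; congr 2 <;> omega
      rw [hl']
      simp only [show n + 4 + 2 = n + 6 from rfl] at hl
      simp only [show n + 5 + 1 = n + 6 from rfl] at hsub hlt
      push_cast at *
      have hn : (0 : ℝ) ≤ n := n.cast_nonneg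
      generalize orient (r l) (r (l + 1)) (r (l + 2)) = e₁ at *
      generalize orient (r (j % (n + 6))) (r ((j + 1) % (n + 6))) (r ((j + 2) % (n + 6))) = e₂ at *
      generalize shoelace (n + 6) (fun i => r (i % (n + 6))) = s' at *
      generalize shoelace (n + 1 + 6) q = s at *
      generalize orient (r (n + 5)) (r (n + 6)) (r (n + 5 + 2)) = e₃ at *
      have hs' : ((n : ℝ) + 1 + 6) * s' ≤ (n + 6) * s := by nlinarith
      have : (n + 6 : ℝ) * ((n + 1 + 6) * e₁) ≤ (n + 6) * s := by
        nlinarith [mul_le_mul_of_nonneg_left hl (show (0 : ℝ) ≤ (n + 6) * (n + 1 + 6) by positivity),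
          mul_le_mul_of_nonneg_left hj (show (0 : ℝ) ≤ n + 1 + 6 by positivity)]
      exact le_of_mul_le_mul_left this (by positivity)

/-- A convex polygon contains, on a subset of its vertices, a convex `m`-gon of at least
proportional area. -/
theorem exists_subpolygon {m : ℕ} (hm : 5 ≤ m) (k : ℕ) {q : ℕ → ℝ × ℝ}
    (h : CyclicConvex (m + k) q) :
    ∃ g : ℕ → ℕ, CyclicConvex m (fun i => q (g i)) ∧
      (m : ℝ) * shoelace (m + k) q ≤ (m + k : ℕ) * shoelace m (fun i => q (g i)) := by
  induction k generalizing q with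
  | zero => exact ⟨id, h, le_rfl⟩
  | succ k ih =>
    obtain ⟨t, rfl⟩ := Nat.exists_eq_add_of_le hm
    have hN : t + k + 6 = 5 + t + (k + 1) := by omega
    obtain ⟨j, hj⟩ := exists_small_ear (t + k) (hN ▸ h)
    have hr := h.shift (j + 2)
    have hS := h.shoelace_shift (j + 2)
    rw [show 5 + t + (k + 1) = 4 + t + k + 2 by omega] at hr
    have hsub := hr.shoelace_deleteLast
    have hper := h.periodic
    rw [show 4 + t + k + 2 = 5 + t + (k + 1) by omega, hS] at hsub
    have hd := CyclicConvex.deleteLast (by omega) hr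
    rw [show 4 + t + k + 1 = 5 + t + k by omega] at hd hsub
    obtain ⟨g, hg, hgS⟩ := ih hd
    refine ⟨_, hg, ?_⟩
    have he : orient (q (4 + t + k + (j + 2))) (q (5 + t + k + (j + 2)))
        (q (5 + t + (k + 1) + (j + 2))) = orient (q j) (q (j + 1)) (q (j + 2)) := by
      rw [← hper j, ← hper (j + 1), ← hper (j + 2)]
      congr 2 <;> omega
    rw [hN] at hj
    rw [he] at hsub
    have hk : (0 : ℝ) < ((5 + t + k : ℕ) : ℝ) := by exact_mod_cast (by omega : 0 < 5 + t + k)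
    have hc : ((5 + t + (k + 1) : ℕ) : ℝ) = ((5 + t + k : ℕ) : ℝ) + 1 := by push_cast; ring
    rw [hc] at hj ⊢
    have hm' : (0 : ℝ) ≤ ((5 + t : ℕ) : ℝ) := Nat.cast_nonneg _
    generalize ((5 + t : ℕ) : ℝ) = M at *
    generalize ((5 + t + k : ℕ) : ℝ) = K at *
    generalize shoelace (5 + t + k) _ = s' at *
    generalize shoelace (5 + t + (k + 1)) q = s at *
    generalize shoelace (5 + t) _ = s₀ at *
    generalize orient _ _ _ = e at *
    have hs : K * s ≤ (K + 1) * s' := by nlinarith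
    refine le_of_mul_le_mul_left ?_ hk
    nlinarith [mul_le_mul_of_nonneg_left hs hm',
      mul_le_mul_of_nonneg_left hgS (show 0 ≤ K + 1 by linarith)]

end CyclicConvex

lemma convex_setOf_orient_nonneg (a b : ℝ × ℝ) : Convex ℝ {x | 0 ≤ orient a b x} := by
  intro x hx y hy s t hs ht hst
  obtain rfl : t = 1 - s := by linarith
  have : orient a b (s • x + (1 - s) • y) = s * orient a b x + (1 - s) * orient a b y := by
    simp only [orient_eq, Prod.fst_add, Prod.snd_add, Prod.smul_fst, Prod.smul_snd, smul_eq_mul]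
    ring
  simp only [Set.mem_ofPred_eq] at hx hy ⊢
  rw [this]
  positivity

lemma Convex.mem_of_orient_nonneg {s : Set (ℝ × ℝ)} (hs : Convex ℝ s) {a b c x : ℝ × ℝ}
    (ha : a ∈ s) (hb : b ∈ s) (hc : c ∈ s) (habc : 0 < orient a b c) (h₁ : 0 ≤ orient a b x)
    (h₂ : 0 ≤ orient b c x) (h₃ : 0 ≤ orient c a x) : x ∈ s := by
  have hsum : orient b c x + orient c a x + orient a b x = orient a b c := by
    simp only [orient_eq]; ring
  have hmem := hs.sum_mem (t := Finset.univ)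
    (w := ![orient b c x / orient a b c, orient c a x / orient a b c,
      orient a b x / orient a b c]) (z := ![a, b, c])
    (by
      intro i _
      fin_cases i
      · exact div_nonneg h₂ habc.le
      · exact div_nonneg h₃ habc.le
      · exact div_nonneg h₁ habc.le)
    (by simp [Fin.sum_univ_three, ← add_div, hsum, habc.ne'])
    (by intro i _; fin_cases i <;> assumption)
  convert hmem using 1
  simp only [Fin.sum_univ_three, Matrix.cons_val]
  ext
  all_goals
    simp only [Prod.fst_add, Prod.snd_add, Prod.smul_fst, Prod.smul_snd, smul_eq_mul]
    field_simp
    simp only [orient_eq]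
    ring

lemma volume_setOf_orient_eq_zero {a b : ℝ × ℝ} (hab : a ≠ b) :
    volume {x | orient a b x = 0} = 0 := by
  let φ : ℝ × ℝ →ₗ[ℝ] ℝ :=
    (b.1 - a.1) • LinearMap.snd ℝ ℝ ℝ - (b.2 - a.2) • LinearMap.fst ℝ ℝ ℝ
  have hφ : AffineSubspace.mk' a φ.ker ≠ ⊤ := by
    intro htop
    have hmem : ∀ x, x ∈ AffineSubspace.mk' a φ.ker := fun x => htop ▸ AffineSubspace.mem_top ℝ _ x
    have h₁ := hmem (a + (1, 0))
    have h₂ := hmem (a + (0, 1))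
    simp [AffineSubspace.mem_mk', φ, sub_eq_zero] at h₁ h₂
    exact hab (Prod.ext (by linarith) (by linarith))
  refine measure_mono_null (fun x hx => ?_) (Measure.addHaar_affineSubspace volume _ hφ)
  simpa [AffineSubspace.mem_mk', φ, orient, cross] using hx

/-- The area of a triangle is a constant multiple of the determinant of its edge vectors. -/
lemma area_triangle (a b c : ℝ × ℝ) :
    area {a, b, c} = area {(0, 0), (1, 0), (0, 1)} * |orient a b c| := by
  let M : Matrix (Fin 2) (Fin 2) ℝ := !![b.1 - a.1, c.1 - a.1; b.2 - a.2, c.2 - a.2]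
  let T := Matrix.toLin (Module.Basis.finTwoProd ℝ) (Module.Basis.finTwoProd ℝ) M
  have hT : LinearMap.det T = orient a b c := by
    rw [LinearMap.det_toLin, Matrix.det_fin_two_of, orient_eq]; ring
  have himg : ({a, b, c} : Set (ℝ × ℝ)) = (fun x => a + x) '' (T '' {(0, 0), (1, 0), (0, 1)}) := by
    have hsub : ∀ x : ℝ × ℝ, a + (x.1 - a.1, x.2 - a.2) = x := fun x => by ext <;> simp
    simp [T, M, Set.image_insert_eq, Matrix.toLin_finTwoProd_apply, hsub, show ((0, 0) : ℝ × ℝ) = 0 from rfl]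
  have hhull : convexHull ℝ ({a, b, c} : Set (ℝ × ℝ)) =
      (fun x => a + x) '' (T '' convexHull ℝ {(0, 0), (1, 0), (0, 1)}) := by
    rw [himg, T.image_convexHull]
    simpa [← Set.image_vadd] using convexHull_vadd (𝕜 := ℝ) a (T '' {(0, 0), (1, 0), (0, 1)})
  rw [area, hhull, Set.image_add_left, measure_preimage_add, Measure.addHaar_image_linearMap, hT,
    ENNReal.toReal_mul, ENNReal.toReal_ofReal (abs_nonneg _), mul_comm, area]

/-- A point on the inner side of every edge of a convex polygon lies in its convex hull. -/
lemma mem_convexHull_of_orient_nonneg {n : ℕ} (hn : 2 ≤ n) {q : ℕ → ℝ × ℝ}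
    (h : ∀ i j k, i < j → j < k → k < n + 1 → 0 < orient (q i) (q j) (q k)) {x : ℝ × ℝ}
    (hx : ∀ i < n, 0 ≤ orient (q i) (q (i + 1)) x) (hx' : 0 ≤ orient (q n) (q 0) x) :
    x ∈ convexHull ℝ (q '' Set.Iio (n + 1)) := by
  have hswap : ∀ i, orient (q i) (q 0) x = -orient (q 0) (q i) x := fun i => by
    simp only [orient_eq]; ring
  obtain ⟨i, hi, hin, h₁, h₂⟩ : ∃ i, 1 ≤ i ∧ i < n ∧ 0 ≤ orient (q 0) (q i) x ∧
      orient (q 0) (q (i + 1)) x ≤ 0 := by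
    by_contra! H
    have hpos : ∀ i, 1 ≤ i → i ≤ n → 0 ≤ orient (q 0) (q i) x := by
      intro i hi
      induction i, hi using Nat.le_induction with
      | base => exact fun _ => hx 0 (by omega)
      | succ i hi ih => exact fun hin => (H i hi (by omega) (ih (by omega))).le
    have := H (n - 1) (by omega) (by omega) (hpos _ (by omega) (by omega))
    rw [Nat.sub_add_cancel (by omega)] at this
    linarith [hswap n]
  have hmem : ∀ j, j < n + 1 → q j ∈ convexHull ℝ (q '' Set.Iio (n + 1)) := fun j hj =>
    subset_convexHull ℝ _ ⟨j, hj, rfl⟩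
  exact (convex_convexHull ℝ _).mem_of_orient_nonneg (hmem 0 (by omega)) (hmem i (by omega))
    (hmem (i + 1) (by omega)) (h _ _ _ (by omega) (by omega) (by omega)) h₁ (hx i hin)
    (by rw [hswap]; linarith)

/-- Appending a vertex to a convex polygon increases its area by that of the new ear. -/
lemma area_image_Iio_succ {n : ℕ} (hn : 2 ≤ n) {q : ℕ → ℝ × ℝ}
    (h : ∀ i j k, i < j → j < k → k < n + 2 → 0 < orient (q i) (q j) (q k)) :
    area (q '' Set.Iio (n + 2)) = area (q '' Set.Iio (n + 1)) + area {q 0, q n, q (n + 1)} := by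
  have hfin : ∀ k, (q '' Set.Iio k).Finite := fun k => (Set.finite_Iio k).image q
  have hT : ({q 0, q n, q (n + 1)} : Set (ℝ × ℝ)).Finite := Set.toFinite _
  have hpos := h 0 n (n + 1) (by omega) (by omega) (by omega)
  have hswap : ∀ x, orient (q n) (q 0) x = -orient (q 0) (q n) x := fun x => by
    simp only [orient_eq]; ring
  have hne : q 0 ≠ q n := by
    intro he
    rw [he] at hpos
    simp [orient_eq] at hpos
  have hunion : convexHull ℝ (q '' Set.Iio (n + 2)) =
      convexHull ℝ (q '' Set.Iio (n + 1)) ∪ convexHull ℝ {q 0, q n, q (n + 1)} := by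
    refine Set.Subset.antisymm (fun x hx => ?_) (Set.union_subset ?_ ?_)
    · have hedge : ∀ i < n + 1, 0 ≤ orient (q i) (q (i + 1)) x := by
        intro i hi
        refine convexHull_min ?_ (convex_setOf_orient_nonneg (q i) (q (i + 1))) hx
        rintro _ ⟨j, hj, rfl⟩
        simp only [Set.mem_Iio, Set.mem_ofPred_eq] at hj ⊢
        rcases lt_trichotomy j i with hji | rfl | hji
        · rw [orient_rotate]; exact (h _ _ _ hji (by omega) (by omega)).le
        · simp [orient_eq]
        · rcases (show i + 1 ≤ j by omega).eq_or_lt with rfl | hji'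
          · simp [orient_eq, mul_comm]
          · exact (h _ _ _ (by omega) hji' hj).le
      have hlast : 0 ≤ orient (q (n + 1)) (q 0) x := by
        refine convexHull_min ?_ (convex_setOf_orient_nonneg (q (n + 1)) (q 0)) hx
        rintro _ ⟨j, hj, rfl⟩
        simp only [Set.mem_Iio, Set.mem_ofPred_eq] at hj ⊢
        rcases Nat.eq_zero_or_pos j with rfl | hj0
        · simp [orient_eq, mul_comm]
        rcases (show j ≤ n + 1 by omega).eq_or_lt with rfl | hjn
        · simp [orient_eq]
        · rw [← orient_rotate]; exact (h _ _ _ hj0 hjn (by omega)).le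
      rcases le_total 0 (orient (q n) (q 0) x) with hside | hside
      · exact Or.inl (mem_convexHull_of_orient_nonneg hn
          (fun i j k h₁ h₂ h₃ => h i j k h₁ h₂ (by omega)) (fun i hi => hedge i (by omega)) hside)
      · refine Or.inr ((convex_convexHull ℝ _).mem_of_orient_nonneg (subset_convexHull ℝ _ ?_)
          (subset_convexHull ℝ _ ?_) (subset_convexHull ℝ _ ?_) hpos
          (by linarith [hswap x]) (hedge n (by omega)) hlast) <;> simp
    · exact convexHull_mono (Set.image_mono (Set.Iio_subset_Iio (by omega)))
    · refine convexHull_mono ?_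
      rintro _ (rfl | rfl | rfl)
      exacts [⟨0, by simp, rfl⟩, ⟨n, by simp, rfl⟩, ⟨n + 1, by simp, rfl⟩]
  have hdisj : AEDisjoint volume (convexHull ℝ (q '' Set.Iio (n + 1)))
      (convexHull ℝ {q 0, q n, q (n + 1)}) := by
    refine measure_mono_null (fun x hx => ?_) (volume_setOf_orient_eq_zero hne)
    have h₁ : 0 ≤ orient (q n) (q 0) x := by
      refine convexHull_min ?_ (convex_setOf_orient_nonneg (q n) (q 0)) hx.1
      rintro _ ⟨j, hj, rfl⟩
      simp only [Set.mem_Iio, Set.mem_ofPred_eq] at hj ⊢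
      rcases Nat.eq_zero_or_pos j with rfl | hj0
      · simp [orient_eq, mul_comm]
      rcases (show j ≤ n by omega).eq_or_lt with rfl | hjn
      · simp [orient_eq]
      · rw [← orient_rotate]; exact (h _ _ _ hj0 hjn (by omega)).le
    have h₂ : 0 ≤ orient (q 0) (q n) x := by
      refine convexHull_min ?_ (convex_setOf_orient_nonneg (q 0) (q n)) hx.2
      rintro _ (rfl | rfl | rfl)
      · simp [orient_eq]
      · simp [orient_eq, mul_comm]
      · exact hpos.le
    exact le_antisymm (by linarith [hswap x]) h₂
  rw [area, hunion, measure_union₀ (hT.isClosed_convexHull (𝕜 := ℝ)).measurableSet.nullMeasurableSet hdisj,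
    ENNReal.toReal_add ((hfin _).isCompact_convexHull ℝ).measure_lt_top.ne
      (hT.isCompact_convexHull ℝ).measure_lt_top.ne]
  rfl

lemma shoelace_eq_sum_orient {n : ℕ} {q : ℕ → ℝ × ℝ} :
    ∑ i ∈ Finset.range n, orient (q 0) (q (i + 1)) (q (i + 2)) =
      shoelace (n + 1) q + cross (q (n + 1)) (q 0) := by
  induction n with
  | zero => simp [shoelace, cross]; ring
  | succ n ih =>
    rw [Finset.sum_range_succ, ih, shoelace, shoelace, Finset.sum_range_succ _ (n + 1)]
    simp only [orient, cross, Prod.fst_sub, Prod.snd_sub]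
    ring

lemma area_image_Iio {n : ℕ} {q : ℕ → ℝ × ℝ}
    (h : ∀ i j k, i < j → j < k → k < n + 3 → 0 < orient (q i) (q j) (q k)) :
    area (q '' Set.Iio (n + 3)) = area {(0, 0), (1, 0), (0, 1)} *
      ∑ i ∈ Finset.range (n + 1), orient (q 0) (q (i + 1)) (q (i + 2)) := by
  induction n with
  | zero =>
    have : q '' Set.Iio 3 = {q 0, q 1, q 2} := by
      have : Set.Iio 3 = ({0, 1, 2} : Set ℕ) := by ext; simp; omega
      rw [this, Set.image_insert_eq, Set.image_pair]
    rw [Nat.zero_add, this, area_triangle, abs_of_pos (h 0 1 2 (by omega) (by omega) (by omega))]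
    simp
  | succ n ih =>
    rw [show n + 1 + 3 = n + 2 + 2 by omega, area_image_Iio_succ (by omega) h,
      ih fun i j k h₁ h₂ h₃ => h i j k h₁ h₂ (by omega), area_triangle (q 0),
      abs_of_pos (h 0 _ _ (by omega) (by omega) (by omega)), Finset.sum_range_succ _ (n + 1), mul_add]

/-- The shoelace formula, up to the area of the standard triangle. -/
theorem CyclicConvex.area_eq {n : ℕ} (hn : 3 ≤ n) {q : ℕ → ℝ × ℝ} (h : CyclicConvex n q) :
    area (q '' Set.Iio n) = area {(0, 0), (1, 0), (0, 1)} * shoelace n q := by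
  obtain ⟨k, rfl⟩ := Nat.exists_eq_add_of_le' hn
  rw [area_image_Iio fun i j l h₁ h₂ h₃ => h.pos i j l h₁ h₂ (by omega), shoelace_eq_sum_orient,
    shoelace, shoelace, Finset.sum_range_succ _ (k + 2),
    show q (k + 2 + 1) = q 0 by simpa using h.periodic 0]

lemma orient_mul_sq (f : ℝ × ℝ) (a b c : ℝ × ℝ) :
    (f.1 ^ 2 + f.2 ^ 2) * orient a b c =
      (f.1 * (b.1 - a.1) + f.2 * (b.2 - a.2)) * cross f (c - a) -
        cross f (b - a) * (f.1 * (c.1 - a.1) + f.2 * (c.2 - a.2)) := by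
  simp only [orient, cross, Prod.fst_sub, Prod.snd_sub]; ring

/-- A point of a finite set in convex position is strictly exposed. -/
lemma exists_separating_of_notMem_convexHull {S : Set (ℝ × ℝ)} (hS : S.Finite) {x : ℝ × ℝ}
    (hx : x ∉ convexHull ℝ S) :
    ∃ f : ℝ × ℝ, ∀ y ∈ S, 0 < f.1 * (y.1 - x.1) + f.2 * (y.2 - x.2) := by
  obtain ⟨f, u, hu, hf⟩ := geometric_hahn_banach_point_closed (convex_convexHull ℝ S)
    (hS.isClosed_convexHull (𝕜 := ℝ)) hx
  refine ⟨(f (1, 0), f (0, 1)), fun y hy => ?_⟩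
  have hsplit : ∀ z : ℝ × ℝ, f z = f (1, 0) * z.1 + f (0, 1) * z.2 := fun z => by
    have hz : z = z.1 • ((1, 0) : ℝ × ℝ) + z.2 • ((0, 1) : ℝ × ℝ) := by ext <;> simp
    conv_lhs => rw [hz, map_add, map_smul, map_smul, smul_eq_mul, smul_eq_mul]
    ring
  have := hf y (subset_convexHull ℝ S hy)
  rw [hsplit] at this hu
  linarith

lemma mem_segment_of_orient_eq_zero {f a b c : ℝ × ℝ}
    (hb : 0 < f.1 * (b.1 - a.1) + f.2 * (b.2 - a.2))
    (hbc : f.1 * (b.1 - a.1) + f.2 * (b.2 - a.2) ≤ f.1 * (c.1 - a.1) + f.2 * (c.2 - a.2))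
    (h : orient a b c = 0) : b ∈ segment ℝ a c := by
  have hc := hb.trans_le hbc
  set β := f.1 * (b.1 - a.1) + f.2 * (b.2 - a.2) with hβ
  set γ := f.1 * (c.1 - a.1) + f.2 * (c.2 - a.2) with hγ
  refine ⟨1 - β / γ, β / γ, sub_nonneg.2 ((div_le_one hc).2 hbc), by positivity, by ring, ?_⟩
  rw [orient_eq] at h
  ext <;> simp only [Prod.fst_add, Prod.snd_add, Prod.smul_fst, Prod.smul_snd, smul_eq_mul] <;>
    field_simp <;> rw [hβ, hγ]
  · linear_combination (-f.2) * h
  · linear_combination f.1 * h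

/-- The vertices of a convex polygon can be listed counterclockwise. -/
lemma exists_perm_orient_pos {n : ℕ} (p : Fin (n + 1) → ℝ × ℝ)
    (hp : ∀ i, p i ∉ convexHull ℝ (p '' {j | j ≠ i})) :
    ∃ σ : Equiv.Perm (Fin (n + 1)),
      ∀ i j k, i < j → j < k → 0 < orient (p (σ i)) (p (σ j)) (p (σ k)) := by
  classical
  obtain ⟨f, hf⟩ := exists_separating_of_notMem_convexHull
    ((Set.toFinite {j : Fin (n + 1) | j ≠ 0}).image p) (hp 0)
  replace hf : ∀ i, i ≠ 0 → 0 < f.1 * ((p i).1 - (p 0).1) + f.2 * ((p i).2 - (p 0).2) :=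
    fun i hi => hf _ ⟨i, hi, rfl⟩
  set g : Fin (n + 1) → ℝ := fun i => f.1 * ((p i).1 - (p 0).1) + f.2 * ((p i).2 - (p 0).2)
  set key : Fin (n + 1) → WithBot ℝ := fun i =>
    if i = 0 then ⊥ else ((cross f (p i - p 0) / g i : ℝ) : WithBot ℝ) with hkey
  have hnotmem : ∀ i j k l, j ≠ i → k ≠ i → l ≠ i →
      p i ∉ convexHull ℝ {p j, p k, p l} := by
    intro i j k l hj hk hl hmem
    refine hp i (convexHull_mono ?_ hmem)
    rintro _ (rfl | rfl | rfl)
    exacts [⟨j, hj, rfl⟩, ⟨k, hk, rfl⟩, ⟨l, hl, rfl⟩]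
  have hseg : ∀ i j, i ≠ 0 → j ≠ 0 → i ≠ j → g i ≤ g j → orient (p 0) (p i) (p j) ≠ 0 := by
    intro i j hi hj hij hle h0
    refine hnotmem i 0 j j hi.symm hij.symm hij.symm ?_
    rw [Set.pair_eq_singleton, convexHull_pair]
    exact mem_segment_of_orient_eq_zero (hf i hi) hle h0
  have hne : ∀ i j, i ≠ 0 → j ≠ 0 → i ≠ j → orient (p 0) (p i) (p j) ≠ 0 := by
    intro i j hi hj hij
    rcases le_total (g i) (g j) with hle | hle
    · exact hseg i j hi hj hij hle
    · intro h0
      refine hseg j i hj hi hij.symm hle ?_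
      simp only [orient_eq] at h0 ⊢
      linarith
  have hpos : ∀ i j, i ≠ 0 → j ≠ 0 → i ≠ j → key i ≤ key j → 0 < orient (p 0) (p i) (p j) := by
    intro i j hi hj hij hle
    simp only [hkey, hi, hj, if_false, WithBot.coe_le_coe] at hle
    rw [div_le_div_iff₀ (hf i hi) (hf j hj)] at hle
    refine lt_of_le_of_ne ?_ (hne i j hi hj hij).symm
    have hsq : 0 < f.1 ^ 2 + f.2 ^ 2 := by
      by_contra! h
      have h1 : f.1 = 0 := by nlinarith [sq_nonneg f.1, sq_nonneg f.2]
      have h2 : f.2 = 0 := by nlinarith [sq_nonneg f.1, sq_nonneg f.2]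
      have := hf i hi
      simp [h1, h2] at this
    refine nonneg_of_mul_nonneg_right (a := f.1 ^ 2 + f.2 ^ 2) ?_ hsq
    rw [orient_mul_sq]
    linarith
  set σ := Tuple.sort key
  have hmono : Monotone (key ∘ σ) := Tuple.monotone_sort key
  have hσ0 : σ 0 = 0 := by
    have h := hmono (Fin.zero_le (σ.symm 0))
    simp only [Function.comp_apply, Equiv.apply_symm_apply] at h
    have hbot : key (σ 0) = ⊥ := le_bot_iff.1 (by simpa [hkey] using h)
    by_contra h0
    simp [hkey, h0] at hbot
  have hσne : ∀ i j, i < j → σ j ≠ 0 := fun i j hij h =>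
    ((Fin.zero_le i).trans_lt hij).ne (σ.injective (hσ0.trans h.symm))
  have hfan : ∀ i j, i ≠ 0 → i < j → 0 < orient (p 0) (p (σ i)) (p (σ j)) := fun i j hi hij =>
    hpos _ _ (hσne 0 i (Fin.pos_of_ne_zero hi)) (hσne i j hij) (σ.injective.ne hij.ne)
      (hmono hij.le)
  refine ⟨σ, fun i j k hij hjk => ?_⟩
  rcases eq_or_ne i 0 with rfl | hi
  · rw [hσ0]
    exact hfan j k hij.ne' hjk
  · have hj : j ≠ 0 := ((Fin.zero_le i).trans_lt hij).ne'
    by_contra! hneg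
    refine hnotmem (σ j) 0 (σ i) (σ k) (hσne i j hij).symm (σ.injective.ne hij.ne)
      (σ.injective.ne hjk.ne') ?_
    refine (convex_convexHull ℝ _).mem_of_orient_nonneg (subset_convexHull ℝ _ (by simp))
      (subset_convexHull ℝ _ (by simp)) (subset_convexHull ℝ _ (by simp))
      (hfan i k hi (hij.trans hjk)) (hfan i j hi hij).le ?_ ?_
    · simp only [orient_eq] at hneg ⊢; linarith
    · rw [← orient_rotate]; exact (hfan j k hj hjk).le

lemma CyclicConvex.injOn {n : ℕ} (hn : 3 ≤ n) {q : ℕ → ℝ × ℝ} (h : CyclicConvex n q) :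
    Set.InjOn q (Set.Iio n) := by
  have key : ∀ i j, i < j → j < n → q i ≠ q j := by
    intro i j hij hj heq
    rcases (show i + 1 ≤ j by omega).eq_or_lt with rfl | hij'
    · have := h.pos i (i + 1) (i + 2) (by omega) (by omega) (by omega)
      rw [← heq] at this
      simp [orient_eq] at this
    · have := h.pos i (i + 1) j (by omega) hij' (by omega)
      rw [← heq] at this
      simp [orient_eq] at this
  intro i hi j hj heq
  rcases lt_trichotomy i j with hij | hij | hij
  · exact (key i j hij hj heq).elim
  · exact hij
  · exact (key j i hij hi heq.symm).elim

/-- For `5 ≤ m < n`, every convex `n`-gon contains an `m`-gon on `m` of its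
vertices whose area is at least `m/n` times the area of the `n`-gon
(that is, `f_n(m) ≥ m/n`). -/
theorem ngon_contains_large_mgon
    (m n : ℕ) (hm : 5 ≤ m) (hmn : m < n)
    (p : Fin n → ℝ × ℝ) (hp : StrictConvexPos p) :
    ∃ s : Finset (Fin n), s.card = m ∧
      ((m : ℝ) / n) * area (Set.range p) ≤ area (p '' ↑s) := by
  obtain ⟨l, rfl⟩ := Nat.exists_eq_add_of_lt hmn
  obtain ⟨σ, hσ⟩ := exists_perm_orient_pos p hp.1
  set v : ℕ → Fin (m + l + 1) := fun i => σ (Fin.ofNat (m + l + 1) i)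
  have hv : ∀ i, v (i % (m + l + 1)) = v i := fun i => by
    simp only [v]; congr 1; ext; simp
  have hq : CyclicConvex (m + (l + 1)) (fun i => p (v i)) := by
    have := CyclicConvex.of_lt (n := m + l + 1) (q := fun i => p (v i)) (by omega)
      fun i j k hij hjk hk => hσ _ _ _
        (by simp [Fin.lt_def, Nat.mod_eq_of_lt, hjk.trans hk, hij.trans (hjk.trans hk), hij])
        (by simp [Fin.lt_def, Nat.mod_eq_of_lt, hk, hjk.trans hk, hjk])
    simp only [hv] at this
    exact this
  obtain ⟨g, hg, hle⟩ := hq.exists_subpolygon hm (l + 1)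
  have hrange : Set.range p = (fun i => p (v i)) '' Set.Iio (m + (l + 1)) := by
    ext x
    constructor
    · rintro ⟨i, rfl⟩
      exact ⟨σ.symm i, (σ.symm i).isLt, by simp [v]⟩
    · rintro ⟨i, -, rfl⟩
      exact ⟨_, rfl⟩
  refine ⟨(Finset.range m).image (fun i => v (g i)), ?_, ?_⟩
  · rw [Finset.card_image_of_injOn, Finset.card_range]
    intro i hi j hj hij
    exact hg.injOn (by omega) (by simpa using hi) (by simpa using hj) (congrArg p hij)
  · have himg : p '' ↑((Finset.range m).image (fun i => v (g i))) =
        (fun i => p (v (g i))) '' Set.Iio m := by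
      rw [Finset.coe_image, Set.image_image, Finset.coe_range]
    rw [himg, hrange, hg.area_eq (by omega), hq.area_eq (by omega), div_mul_eq_mul_div,
      div_le_iff₀ (by positivity)]
    have hc : 0 ≤ area {(0, 0), (1, 0), (0, 1)} := ENNReal.toReal_nonneg
    have := mul_le_mul_of_nonneg_left hle hc
    simp only [← add_assoc] at this ⊢
    linarith
end

section
/- For every n ≥ 4, every convex n-gon has an ear (a triangle formed by three consecutive vertices) whose area is at most (4/n)·sin²(2π/n) times the area of the n-gon. (That is, g_n ≤ (4/n)·sin²(2π/n).) -/
open MeasureTheory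

/-- The cross product (twice the signed area) of the triangle `a b c`. -/
def Cross (a b c : ℝ × ℝ) : ℝ :=
  (b.1 - a.1) * (c.2 - a.2) - (b.2 - a.2) * (c.1 - a.1)

/-- The vertices `p 0, p 1, …, p (n-1)` are labeled in cyclic order around their
convex hull: all remaining vertices lie strictly on one and the same side of
each directed edge `p i → p (i+1)`. -/
def ConvexCyclic {n : ℕ} [NeZero n] (p : Fin n → ℝ × ℝ) : Prop :=
  (∀ i j : Fin n, j ≠ i → j ≠ i + 1 → 0 < Cross (p i) (p (i + 1)) (p j)) ∨
  (∀ i j : Fin n, j ≠ i → j ≠ i + 1 → Cross (p i) (p (i + 1)) (p j) < 0)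

open Set

/-- The open unit right triangle. -/
def openStdTriangle : Set (ℝ × ℝ) := {z | 0 < z.1 ∧ 0 < z.2 ∧ z.1 + z.2 < 1}

/-- The affine parametrization of the plane with origin `a` and frame `u`, `w`. -/
def frameMap (a u w : ℝ × ℝ) (z : ℝ × ℝ) : ℝ × ℝ := a + (z.1 • u + z.2 • w)

theorem volume_image_frameMap (a u w : ℝ × ℝ) (S : Set (ℝ × ℝ)) :
    volume (frameMap a u w '' S) = ENNReal.ofReal |u.1 * w.2 - u.2 * w.1| * volume S := by
  let L : ℝ × ℝ →ₗ[ℝ] ℝ × ℝ :=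
    (LinearMap.fst ℝ ℝ ℝ).smulRight u + (LinearMap.snd ℝ ℝ ℝ).smulRight w
  have hdet : LinearMap.det L = u.1 * w.2 - u.2 * w.1 := by
    rw [← LinearMap.det_toMatrix (Module.Basis.finTwoProd ℝ), Matrix.det_fin_two]
    simp [L, LinearMap.toMatrix_apply]
    ring
  have himage : frameMap a u w '' S = (fun z => a + z) '' (L '' S) := by
    rw [image_image]
    rfl
  rw [himage, Set.image_add_left, measure_preimage_add, Measure.addHaar_image_linearMap, hdet]

theorem volume_openStdTriangle : volume openStdTriangle = ENNReal.ofReal (1 / 2) := by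
  have hregion : openStdTriangle = regionBetween (fun _ => 0) (fun x => 1 - x) (Ioc (0 : ℝ) 1) := by
    ext ⟨x, y⟩
    simp only [openStdTriangle, regionBetween, mem_ofPred_eq, mem_Ioc, mem_Ioo]
    grind
  rw [hregion, Measure.volume_eq_prod, volume_regionBetween_eq_integral
    continuous_const.integrableOn_Ioc (Continuous.integrableOn_Ioc (by fun_prop)) measurableSet_Ioc
    (fun x hx => by linarith [hx.2])]
  congr 1
  rw [← intervalIntegral.integral_of_le zero_le_one]
  simp only [Pi.sub_apply, sub_zero]
  rw [intervalIntegral.integral_sub (by simp) (by simp)]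
  norm_num [integral_id]

theorem volume_closedStdTriangle_le :
    volume {z : ℝ × ℝ | 0 ≤ z.1 ∧ 0 ≤ z.2 ∧ z.1 + z.2 ≤ 1} ≤ ENNReal.ofReal (1 / 2) := by
  have hsub : frameMap (1, 1) (-1, 0) (0, -1) '' {z : ℝ × ℝ | 0 ≤ z.1 ∧ 0 ≤ z.2 ∧ z.1 + z.2 ≤ 1} ⊆
      Icc (0 : ℝ) 1 ×ˢ Icc (0 : ℝ) 1 \ openStdTriangle := by
    rintro _ ⟨⟨x, y⟩, hz, rfl⟩
    simp only [frameMap, openStdTriangle, mem_sdiff, mem_prod, mem_Icc, mem_ofPred_eq] at hz ⊢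
    simp
    grind
  have hO : openStdTriangle ⊆ Icc (0 : ℝ) 1 ×ˢ Icc (0 : ℝ) 1 := by
    rintro ⟨x, y⟩ ⟨h₁, h₂, h₃⟩
    simp only [mem_prod, mem_Icc] at *
    grind
  have hmeas : MeasurableSet openStdTriangle :=
    (measurableSet_lt measurable_const measurable_fst).inter
      ((measurableSet_lt measurable_const measurable_snd).inter
        (measurableSet_lt (measurable_fst.add measurable_snd) measurable_const))
  have hle := measure_mono (μ := volume) hsub
  rw [volume_image_frameMap, measure_sdiff hO hmeas.nullMeasurableSet
    (by rw [volume_openStdTriangle]; exact ENNReal.ofReal_ne_top), volume_openStdTriangle,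
    Measure.volume_eq_prod, Measure.prod_prod, Real.volume_Icc] at hle
  norm_num at hle
  refine hle.trans (le_of_eq ?_)
  rw [← ENNReal.ofReal_one, ← ENNReal.ofReal_sub _ (by norm_num)]
  norm_num

theorem convex_openStdTriangle : Convex ℝ openStdTriangle := by
  rintro ⟨x, y⟩ ⟨h₁, h₂, h₃⟩ ⟨x', y'⟩ ⟨h₁', h₂', h₃'⟩ s t hs ht hst
  simp only [openStdTriangle, mem_ofPred_eq, Prod.smul_mk, Prod.mk_add_mk, smul_eq_mul] at *
  obtain rfl : s = 1 - t := by linarith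
  rcases eq_or_lt_of_le ht with rfl | ht
  · simpa using ⟨h₁, h₂, h₃⟩
  · refine ⟨?_, ?_, ?_⟩ <;> nlinarith

theorem nullMeasurableSet_frameMap_image (a u w : ℝ × ℝ) :
    NullMeasurableSet (frameMap a u w '' openStdTriangle) := by
  refine Convex.nullMeasurableSet _ ?_
  have himage : frameMap a u w '' openStdTriangle = (fun z => a + z) ''
      (((LinearMap.fst ℝ ℝ ℝ).smulRight u + (LinearMap.snd ℝ ℝ ℝ).smulRight w) ''
        openStdTriangle) := by
    rw [image_image]
    rfl
  rw [himage]
  exact (convex_openStdTriangle.linear_image _).translate a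

theorem area_triangle_le (a b c : ℝ × ℝ) : area {a, b, c} ≤ |Cross a b c| / 2 := by
  have hsub : convexHull ℝ {a, b, c} ⊆
      frameMap a (b - a) (c - a) '' {z : ℝ × ℝ | 0 ≤ z.1 ∧ 0 ≤ z.2 ∧ z.1 + z.2 ≤ 1} := by
    rintro z hz
    rw [convexHull_insert (by simp), convexHull_pair, mem_convexJoin] at hz
    obtain ⟨_, rfl, y, ⟨s, t, hs, ht, hst, rfl⟩, ⟨s', t', hs', ht', hst', rfl⟩⟩ := hz
    refine ⟨(t' * s, t' * t), ⟨by positivity, by positivity, ?_⟩, ?_⟩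
    · have : t' * s + t' * t = t' := by rw [← mul_add, hst, mul_one]
      simp only [this]
      linarith
    · obtain rfl : s = 1 - t := by linarith
      obtain rfl : s' = 1 - t' := by linarith
      simp only [frameMap]
      module
  have hvol := (measure_mono (μ := volume) hsub).trans_eq (volume_image_frameMap _ _ _ _)
  have hle := hvol.trans (mul_le_mul_right volume_closedStdTriangle_le _)
  rw [← ENNReal.ofReal_mul (abs_nonneg _)] at hle
  refine (ENNReal.toReal_le_of_le_ofReal (by positivity) hle).trans (le_of_eq ?_)
  simp only [Cross, Prod.fst_sub, Prod.snd_sub]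
  ring

theorem frameMap_image_subset_convexHull {S : Set (ℝ × ℝ)} {a b c : ℝ × ℝ} (ha : a ∈ S) (hb : b ∈ S)
    (hc : c ∈ S) : frameMap a (b - a) (c - a) '' openStdTriangle ⊆ convexHull ℝ S := by
  rintro _ ⟨⟨s, t⟩, ⟨hs, ht, hst⟩, rfl⟩
  simp only at hs ht hst
  have h := (convex_convexHull ℝ S).sum_mem (t := Finset.univ) (w := ![1 - s - t, s, t])
    (z := ![a, b, c]) (by intro i _; fin_cases i <;> simp <;> linarith)
    (by simp [Fin.sum_univ_three]; ring)
    (by intro i _; fin_cases i <;> simp <;> exact subset_convexHull ℝ S ‹_›)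
  convert h using 1
  simp [Fin.sum_univ_three, frameMap]
  module

theorem cross_frameMap (a b c : ℝ × ℝ) (z : ℝ × ℝ) :
    Cross a b (frameMap a (b - a) (c - a) z) = z.2 * Cross a b c := by
  simp [Cross, frameMap]
  ring

/-- Two vertices `c`, `d` on opposite sides of the diagonal `a b` bound the area from below. -/
theorem cross_sub_cross_le_area {S : Set (ℝ × ℝ)} (hS : S.Finite) {a b c d : ℝ × ℝ}
    (ha : a ∈ S) (hb : b ∈ S) (hc : c ∈ S) (hd : d ∈ S)
    (hc₀ : 0 ≤ Cross a b c) (hd₀ : Cross a b d ≤ 0) :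
    Cross a b c - Cross a b d ≤ 2 * area S := by
  have hfin : volume (convexHull ℝ S) ≠ ⊤ :=
    ((isBounded_convexHull.2 hS.isBounded).measure_lt_top).ne
  have hdisj : AEDisjoint volume (frameMap a (b - a) (c - a) '' openStdTriangle)
      (frameMap a (b - a) (d - a) '' openStdTriangle) := by
    rcases hc₀.eq_or_lt with hc₀ | hc₀
    · refine measure_mono_null inter_subset_left ?_
      rw [volume_image_frameMap]
      simp only [Cross] at hc₀
      simp [← hc₀]
    · refine Disjoint.aedisjoint (disjoint_left.2 ?_)
      rintro _ ⟨z, hz, rfl⟩ ⟨z', hz', h⟩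
      have h₁ := cross_frameMap a b c z
      rw [← h, cross_frameMap] at h₁
      have := mul_pos hz.2.1 hc₀
      have := mul_nonpos_of_nonneg_of_nonpos hz'.2.1.le hd₀
      linarith
  have hle := measure_mono (μ := volume) (union_subset
    (frameMap_image_subset_convexHull ha hb hc) (frameMap_image_subset_convexHull ha hb hd))
  rw [measure_union₀ (nullMeasurableSet_frameMap_image _ _ _) hdisj, volume_image_frameMap,
    volume_image_frameMap, volume_openStdTriangle, ← ENNReal.ofReal_mul (abs_nonneg _),
    ← ENNReal.ofReal_mul (abs_nonneg _), ← ENNReal.ofReal_add (by positivity) (by positivity),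
    ENNReal.ofReal_le_iff_le_toReal hfin] at hle
  change |Cross a b c| * (1 / 2) + |Cross a b d| * (1 / 2) ≤ area S at hle
  rw [abs_of_nonneg hc₀, abs_of_nonpos hd₀] at hle
  linarith

/-- Open intervals between consecutive abscissas of a closed polygon in convex position
do not overlap. -/
theorem disjoint_Ioo_of_cross_pos {a b c d : ℝ × ℝ} (hc : 0 ≤ Cross a b c) (hd : 0 ≤ Cross a b d)
    (hcd : 0 < Cross a b c + Cross a b d) (ha : 0 ≤ Cross c d a) (hb : 0 ≤ Cross c d b) :
    Disjoint (Ioo a.1 b.1) (Ioo c.1 d.1) := by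
  refine disjoint_left.2 fun t ht ht' => ?_
  have h₁ := mul_nonneg (sub_pos.2 ht'.2).le hc
  have h₂ := mul_nonneg (sub_pos.2 ht'.1).le hd
  have h₃ := mul_nonneg (sub_pos.2 ht.2).le ha
  have h₄ := mul_nonneg (sub_pos.2 ht.1).le hb
  have hsum : (d.1 - t) * Cross a b c + (t - c.1) * Cross a b d +
      ((b.1 - t) * Cross c d a + (t - a.1) * Cross c d b) = 0 := by
    simp only [Cross]
    ring
  have h₅ : (d.1 - t) * Cross a b c = 0 := by linarith
  have h₆ : (t - c.1) * Cross a b d = 0 := by linarith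
  have h₇ := (mul_eq_zero.1 h₅).resolve_left (sub_pos.2 ht'.2).ne'
  have h₈ := (mul_eq_zero.1 h₆).resolve_left (sub_pos.2 ht'.1).ne'
  linarith

section Polygon

variable {n : ℕ} [NeZero n] {q : Fin n → ℝ × ℝ}

theorem fin_one_add_one_ne_zero (hn : 3 ≤ n) : (1 : Fin n) + 1 ≠ 0 := by
  intro h
  have h' := congrArg Fin.val h
  rw [Fin.val_add, Fin.val_one', Nat.mod_eq_of_lt (show 1 < n by omega),
    Nat.mod_eq_of_lt (show 1 + 1 < n by omega)] at h'
  simp at h'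

theorem cross_nonneg (hq : ∀ i j : Fin n, j ≠ i → j ≠ i + 1 → 0 < Cross (q i) (q (i + 1)) (q j))
    (i j : Fin n) : 0 ≤ Cross (q i) (q (i + 1)) (q j) := by
  by_cases h₁ : j = i
  · simp [h₁, Cross]
  · by_cases h₂ : j = i + 1
    · simp [h₂, Cross, mul_comm]
    · exact (hq i j h₁ h₂).le

theorem sum_abs_fst_le_two (hn : 3 ≤ n)
    (hq : ∀ i j : Fin n, j ≠ i → j ≠ i + 1 → 0 < Cross (q i) (q (i + 1)) (q j))
    (a : ℝ) (ha : ∀ i, (q i).1 ∈ Icc a (a + 1)) :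
    ∑ i, |(q (i + 1)).1 - (q i).1| ≤ 2 := by
  have hdisj : Pairwise (Function.onFun Disjoint fun i => Ioo (q i).1 (q (i + 1)).1) := by
    intro i j hij
    refine disjoint_Ioo_of_cross_pos (cross_nonneg hq i j) (cross_nonneg hq i (j + 1)) ?_
      (cross_nonneg hq j i) (cross_nonneg hq j (i + 1))
    by_cases h : j = i + 1
    · refine add_pos_of_nonneg_of_pos (cross_nonneg hq i j) (hq i (j + 1) ?_ ?_)
      · rw [h, add_assoc]
        simpa using fin_one_add_one_ne_zero hn
      · rw [h]
        simp
        omega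
    · exact add_pos_of_pos_of_nonneg (hq i j hij.symm h) (cross_nonneg hq i (j + 1))
  have hvol := measure_mono (μ := volume) (iUnion_subset fun i =>
    Ioo_subset_Icc_self.trans (Icc_subset_Icc (ha i).1 (ha (i + 1)).2))
  rw [measure_iUnion hdisj fun _ => measurableSet_Ioo, tsum_fintype] at hvol
  simp only [Real.volume_Ioo, Real.volume_Icc] at hvol
  have hpos : ∑ i, max ((q (i + 1)).1 - (q i).1) 0 ≤ 1 := by
    have h := ENNReal.toReal_mono ENNReal.ofReal_ne_top hvol
    rw [ENNReal.toReal_sum fun _ _ => ENNReal.ofReal_ne_top] at h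
    simpa [ENNReal.toReal_ofReal'] using h
  have hshift : ∑ i, (q (i + 1)).1 = ∑ i, (q i).1 :=
    Equiv.sum_comp (Equiv.addRight (1 : Fin n)) fun i => (q i).1
  calc ∑ i, |(q (i + 1)).1 - (q i).1|
      = ∑ i, (2 * max ((q (i + 1)).1 - (q i).1) 0 - ((q (i + 1)).1 - (q i).1)) := by
        refine Finset.sum_congr rfl fun i _ => ?_
        grind
    _ = 2 * ∑ i, max ((q (i + 1)).1 - (q i).1) 0 := by
        rw [Finset.sum_sub_distrib, Finset.sum_sub_distrib, hshift, Finset.mul_sum]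
        ring
    _ ≤ 2 := by linarith

theorem sum_abs_snd_le_two (hn : 3 ≤ n)
    (hq : ∀ i j : Fin n, j ≠ i → j ≠ i + 1 → 0 < Cross (q i) (q (i + 1)) (q j))
    (b : ℝ) (hb : ∀ i, (q i).2 ∈ Icc b (b + 1)) :
    ∑ i, |(q (i + 1)).2 - (q i).2| ≤ 2 := by
  refine sum_abs_fst_le_two (q := fun i => ((q i).2, -(q i).1)) hn (fun i j h₁ h₂ => ?_) b hb
  refine (hq i j h₁ h₂).trans_eq ?_
  simp only [Cross]
  ring

/-- The `ℓ¹` length of the edge from `a` to `b`. -/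
def taxiDist (a b : ℝ × ℝ) : ℝ := |b.1 - a.1| + |b.2 - a.2|

theorem taxiDist_nonneg (a b : ℝ × ℝ) : 0 ≤ taxiDist a b := by
  unfold taxiDist
  positivity

theorem taxiDist_pos {a b c : ℝ × ℝ} (h : 0 < Cross a b c) : 0 < taxiDist a b := by
  refine (taxiDist_nonneg a b).lt_of_ne' fun h₀ => ?_
  unfold taxiDist at h₀
  have h₁ : b.1 - a.1 = 0 := abs_nonpos_iff.1 (by linarith [abs_nonneg (b.2 - a.2)])
  have h₂ : b.2 - a.2 = 0 := abs_nonpos_iff.1 (by linarith [abs_nonneg (b.1 - a.1)])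
  simp [Cross, h₁, h₂] at h

/-- The direction of the edge from `a` to `b`, normalized in the `ℓ¹` norm. -/
noncomputable def taxiDir (a b : ℝ × ℝ) : ℝ × ℝ := (taxiDist a b)⁻¹ • (b - a)

theorem abs_taxiDir_le (a b : ℝ × ℝ) : |(taxiDir a b).1| + |(taxiDir a b).2| ≤ 1 := by
  simp only [taxiDir, Prod.smul_fst, Prod.smul_snd, Prod.fst_sub, Prod.snd_sub, smul_eq_mul,
    abs_mul, ← mul_add, abs_inv, abs_of_nonneg (taxiDist_nonneg a b)]
  exact inv_mul_le_one

theorem volume_taxiBall_le : volume {z : ℝ × ℝ | |z.1| + |z.2| ≤ 1} ≤ ENNReal.ofReal 2 := by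
  have hsub : frameMap 0 (1, 1) (1, -1) '' {z : ℝ × ℝ | |z.1| + |z.2| ≤ 1} ⊆
      Icc (-1) 1 ×ˢ Icc (-1) 1 := by
    rintro _ ⟨⟨x, y⟩, hz, rfl⟩
    simp only [frameMap, mem_prod, mem_Icc, mem_ofPred_eq] at hz ⊢
    simp
    grind
  have hle := measure_mono (μ := volume) hsub
  rw [volume_image_frameMap, Measure.volume_eq_prod, Measure.prod_prod, Real.volume_Icc] at hle
  norm_num at hle
  refine (ENNReal.mul_le_mul_iff_right (a := 2) (by simp) (by simp)).1 (hle.trans ?_)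
  norm_num

theorem fin_add_one_ne_sub_one (hn : 3 ≤ n) (i : Fin n) : i + 1 ≠ i - 1 := by
  intro h
  refine fin_one_add_one_ne_zero hn (add_left_cancel (a := i) ?_)
  rw [← add_assoc, h, sub_add_cancel, add_zero]

theorem cross_prev_pos (hn : 3 ≤ n)
    (hq : ∀ i j : Fin n, j ≠ i → j ≠ i + 1 → 0 < Cross (q i) (q (i + 1)) (q j)) (i : Fin n) :
    0 < Cross (q (i - 1)) (q i) (q (i + 1)) := by
  have h := hq (i - 1) (i + 1) (fin_add_one_ne_sub_one hn i)
  rw [sub_add_cancel] at h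
  refine h fun h' => fin_one_add_one_ne_zero hn ?_
  have h₁ : (1 : Fin n) = 0 := by simpa using h'
  rw [h₁, add_zero]

/-- The vertex `q i` is extreme in the directions of the cone spanned by its two edges. -/
theorem det_pos_of_mem_cone (hn : 3 ≤ n)
    (hq : ∀ i j : Fin n, j ≠ i → j ≠ i + 1 → 0 < Cross (q i) (q (i + 1)) (q j))
    {i j : Fin n} (hij : j ≠ i) {z : ℝ × ℝ}
    (hz : z ∈ frameMap 0 (taxiDir (q (i - 1)) (q i)) (taxiDir (q i) (q (i + 1))) ''
      openStdTriangle) :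
    0 < z.1 * ((q j).2 - (q i).2) - z.2 * ((q j).1 - (q i).1) := by
  obtain ⟨⟨s, t⟩, ⟨hs, ht, -⟩, rfl⟩ := hz
  simp only at hs ht
  have hprev := cross_nonneg hq (i - 1) j
  rw [sub_add_cancel] at hprev
  have hnext := cross_nonneg hq i j
  have hear := cross_prev_pos hn hq i
  have hear' : 0 < Cross (q i) (q (i + 1)) (q (i - 1)) := by
    refine hear.trans_eq ?_
    simp only [Cross]
    ring
  have h₁ := mul_pos hs (inv_pos.2 (taxiDist_pos hear))
  have h₂ := mul_pos ht (inv_pos.2 (taxiDist_pos hear'))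
  have hsum : (frameMap 0 (taxiDir (q (i - 1)) (q i)) (taxiDir (q i) (q (i + 1))) (s, t)).1 *
      ((q j).2 - (q i).2) - (frameMap 0 (taxiDir (q (i - 1)) (q i))
        (taxiDir (q i) (q (i + 1))) (s, t)).2 * ((q j).1 - (q i).1) =
      s * (taxiDist (q (i - 1)) (q i))⁻¹ * Cross (q (i - 1)) (q i) (q j) +
        t * (taxiDist (q i) (q (i + 1)))⁻¹ * Cross (q i) (q (i + 1)) (q j) := by
    simp [frameMap, taxiDir, Cross]
    ring
  rw [hsum]
  by_cases h : j = i + 1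
  · rw [h] at hnext ⊢
    exact add_pos_of_pos_of_nonneg (mul_pos h₁ hear) (mul_nonneg h₂.le hnext)
  · exact add_pos_of_nonneg_of_pos (mul_nonneg h₁.le hprev) (mul_pos h₂ (hq i j hij h))

/-- A discrete form of the fact that the total turning of a convex polygon is one full turn. -/
theorem sum_cross_div_taxiDist_le_four (hn : 3 ≤ n)
    (hq : ∀ i j : Fin n, j ≠ i → j ≠ i + 1 → 0 < Cross (q i) (q (i + 1)) (q j)) :
    ∑ i, Cross (q (i - 1)) (q i) (q (i + 1)) /
      (taxiDist (q (i - 1)) (q i) * taxiDist (q i) (q (i + 1))) ≤ 4 := by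
  set T : Fin n → Set (ℝ × ℝ) := fun i =>
    frameMap 0 (taxiDir (q (i - 1)) (q i)) (taxiDir (q i) (q (i + 1))) '' openStdTriangle
  have hdisj : Pairwise (Function.onFun (AEDisjoint volume) T) := by
    intro i j hij
    refine Disjoint.aedisjoint (disjoint_left.2 fun z hz hz' => ?_)
    have h₁ := det_pos_of_mem_cone hn hq hij.symm hz
    have h₂ := det_pos_of_mem_cone hn hq hij hz'
    linarith
  have hsub : ⋃ i, T i ⊆ {z : ℝ × ℝ | |z.1| + |z.2| ≤ 1} := by
    refine iUnion_subset fun i => ?_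
    rintro _ ⟨⟨s, t⟩, ⟨hs, ht, hst⟩, rfl⟩
    simp only at hs ht hst
    have h₁ := abs_taxiDir_le (q (i - 1)) (q i)
    have h₂ := abs_taxiDir_le (q i) (q (i + 1))
    generalize taxiDir (q (i - 1)) (q i) = u at *
    generalize taxiDir (q i) (q (i + 1)) = w at *
    have h₃ := abs_add_le (s * u.1) (t * w.1)
    have h₄ := abs_add_le (s * u.2) (t * w.2)
    simp only [abs_mul, abs_of_pos hs, abs_of_pos ht] at h₃ h₄
    simp [frameMap]
    nlinarith
  have hvol := (measure_mono (μ := volume) hsub).trans volume_taxiBall_le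
  rw [measure_iUnion₀ hdisj fun _ => nullMeasurableSet_frameMap_image _ _ _, tsum_fintype] at hvol
  have hT : ∀ i, volume (T i) = ENNReal.ofReal (Cross (q (i - 1)) (q i) (q (i + 1)) /
      (taxiDist (q (i - 1)) (q i) * taxiDist (q i) (q (i + 1))) / 2) := by
    intro i
    have hnonneg : 0 ≤ Cross (q (i - 1)) (q i) (q (i + 1)) /
        (taxiDist (q (i - 1)) (q i) * taxiDist (q i) (q (i + 1))) :=
      div_nonneg (cross_prev_pos hn hq i).le (mul_nonneg (taxiDist_nonneg _ _) (taxiDist_nonneg _ _))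
    have hdet : (taxiDir (q (i - 1)) (q i)).1 * (taxiDir (q i) (q (i + 1))).2 -
        (taxiDir (q (i - 1)) (q i)).2 * (taxiDir (q i) (q (i + 1))).1 =
        Cross (q (i - 1)) (q i) (q (i + 1)) /
          (taxiDist (q (i - 1)) (q i) * taxiDist (q i) (q (i + 1))) := by
      simp [taxiDir, Cross, div_eq_mul_inv]
      ring
    simp only [T]
    rw [volume_image_frameMap, hdet, volume_openStdTriangle, abs_of_nonneg hnonneg,
      ← ENNReal.ofReal_mul hnonneg, mul_one_div]
  simp only [hT] at hvol
  have h := ENNReal.toReal_mono ENNReal.ofReal_ne_top hvol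
  rw [ENNReal.toReal_sum fun _ _ => ENNReal.ofReal_ne_top] at h
  have hle := (Finset.sum_le_sum fun i _ => by
    rw [ENNReal.toReal_ofReal']; exact le_max_left _ _ : ∑ i, Cross (q (i - 1)) (q i) (q (i + 1)) /
      (taxiDist (q (i - 1)) (q i) * taxiDist (q i) (q (i + 1))) / 2 ≤ _).trans h
  rw [← Finset.sum_div, ENNReal.toReal_ofReal zero_le_two] at hle
  linarith

theorem three_lt_add_of_one_lt_mul {x y z : ℝ} (hx : 0 < x) (hy : 0 < y) (hz : 0 < z)
    (h : 1 < x * y * z) : 3 < x + y + z := by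
  by_contra! hle
  have h₁ : (x * y * z) ≤ ((x + y + z) / 3) ^ 3 := by
    nlinarith [mul_nonneg hx.le (sq_nonneg (y - z)), mul_nonneg hy.le (sq_nonneg (x - z)),
      mul_nonneg hz.le (sq_nonneg (x - y)), mul_nonneg hx.le (sq_nonneg (x - y)),
      mul_nonneg hx.le (sq_nonneg (x - z)), mul_nonneg hy.le (sq_nonneg (x - y)),
      mul_nonneg hy.le (sq_nonneg (y - z)), mul_nonneg hz.le (sq_nonneg (x - z)),
      mul_nonneg hz.le (sq_nonneg (y - z))]
  have h₂ : ((x + y + z) / 3) ^ 3 ≤ 1 := pow_le_one₀ (by positivity) (by linarith)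
  linarith

/-- A convex polygon in a unit square has a small ear. -/
theorem exists_cross_le_of_mem_unit_square (hn : 3 ≤ n)
    (hq : ∀ i j : Fin n, j ≠ i → j ≠ i + 1 → 0 < Cross (q i) (q (i + 1)) (q j))
    (a b : ℝ) (ha : ∀ i, (q i).1 ∈ Icc a (a + 1)) (hb : ∀ i, (q i).2 ∈ Icc b (b + 1)) :
    ∃ i, Cross (q (i - 1)) (q i) (q (i + 1)) ≤ 64 / (n : ℝ) ^ 3 := by
  by_contra! hlt
  have hn₀ : (0 : ℝ) < n := by positivity
  set l : Fin n → ℝ := fun i => taxiDist (q i) (q (i + 1)) with hl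
  set τ : Fin n → ℝ := fun i => Cross (q (i - 1)) (q i) (q (i + 1)) / (l (i - 1) * l i) with hτ
  have hlprev : ∀ i, l (i - 1) = taxiDist (q (i - 1)) (q i) := fun i => by simp [hl]
  have hl₀ : ∀ i, 0 < l i := fun i => by
    have h := cross_prev_pos hn hq (i + 1)
    rw [add_sub_cancel_right] at h
    exact taxiDist_pos h
  have hτ₀ : ∀ i, 0 < τ i := fun i =>
    div_pos (cross_prev_pos hn hq i) (mul_pos (hl₀ _) (hl₀ _))
  have hsuml : ∑ i, l i ≤ 4 := by
    simp only [hl, taxiDist, Finset.sum_add_distrib]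
    linarith [sum_abs_fst_le_two hn hq a ha, sum_abs_snd_le_two hn hq b hb]
  have hsuml' : ∑ i, l (i - 1) = ∑ i, l i := Equiv.sum_comp (Equiv.subRight (1 : Fin n)) l
  have hsumτ : ∑ i, τ i ≤ 4 := by
    simp only [hτ, hlprev]
    exact sum_cross_div_taxiDist_le_four hn hq
  have hthree : ∀ i, 3 < n / 4 * (l (i - 1) + l i + τ i) := by
    intro i
    have h₀ : (0 : ℝ) < n / 4 := by positivity
    have h := three_lt_add_of_one_lt_mul (mul_pos h₀ (hl₀ (i - 1))) (mul_pos h₀ (hl₀ i))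
      (mul_pos h₀ (hτ₀ i)) ?_
    · linarith
    · have hprod : l (i - 1) * l i * τ i = Cross (q (i - 1)) (q i) (q (i + 1)) :=
        mul_div_cancel₀ _ (mul_pos (hl₀ _) (hl₀ _)).ne'
      have h := hlt i
      rw [← hprod, div_lt_iff₀ (by positivity)] at h
      linarith
  have hsum := Finset.sum_lt_sum_of_nonempty (s := Finset.univ) ⟨0, Finset.mem_univ _⟩
    fun i _ => hthree i
  rw [← Finset.mul_sum, Finset.sum_add_distrib, Finset.sum_add_distrib, hsuml'] at hsum
  simp at hsum
  nlinarith

end Polygon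

/-- For `n ≥ 4`, every convex `n`-gon has an ear whose area is at most
`(4/n)·sin²(2π/n)` times the area of the `n`-gon (that is,
`g_n ≤ (4/n)·sin²(2π/n)`). -/
theorem ngon_small_ear_sin_bound
    (n : ℕ) [NeZero n] (hn : 4 ≤ n)
    (p : Fin n → ℝ × ℝ) (hp : StrictConvexPos p) (hcyc : ConvexCyclic p) :
    ∃ i : Fin n, area {p (i - 1), p i, p (i + 1)} ≤
      (4 / (n : ℝ)) * Real.sin (2 * Real.pi / n) ^ 2 * area (Set.range p) := by
  have hn₀ : (0 : ℝ) < n := by positivity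
  obtain ⟨ε, hε, hpos⟩ : ∃ ε : ℝ, |ε| = 1 ∧
      ∀ i j : Fin n, j ≠ i → j ≠ i + 1 → 0 < ε * Cross (p i) (p (i + 1)) (p j) := by
    rcases hcyc with h | h
    · exact ⟨1, by simp, fun i j h₁ h₂ => by simpa using h i j h₁ h₂⟩
    · exact ⟨-1, by simp, fun i j h₁ h₂ => by simpa using h i j h₁ h₂⟩
  -- `a` and `b` realize the Euclidean diameter of the vertex set
  obtain ⟨⟨i₀, j₀⟩, hmax⟩ := Finite.exists_max fun ij : Fin n × Fin n =>
    ((p ij.2).1 - (p ij.1).1) ^ 2 + ((p ij.2).2 - (p ij.1).2) ^ 2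
  simp only [Prod.forall] at hmax
  set a := p i₀
  set b := p j₀
  set D := (b.1 - a.1) ^ 2 + (b.2 - a.2) ^ 2 with hD
  obtain ⟨k, hk⟩ := Finite.exists_max fun i => ε * Cross a b (p i)
  obtain ⟨m, hm⟩ := Finite.exists_min fun i => ε * Cross a b (p i)
  set H := ε * Cross a b (p k) - ε * Cross a b (p m) with hH
  have hk₀ : 0 ≤ ε * Cross a b (p k) := by
    refine (hk i₀).trans' (le_of_eq ?_)
    simp [Cross, a]
  have hm₀ : ε * Cross a b (p m) ≤ 0 := by
    refine (hm i₀).trans (le_of_eq ?_)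
    simp [Cross, a]
  have hH_area : H ≤ 2 * area (range p) := by
    rcases (abs_eq zero_le_one).1 hε with rfl | rfl
    · have := cross_sub_cross_le_area (finite_range p) (mem_range_self i₀) (mem_range_self j₀)
        (mem_range_self k) (mem_range_self m) (by linarith) (by linarith)
      linarith
    · have := cross_sub_cross_le_area (finite_range p) (mem_range_self i₀) (mem_range_self j₀)
        (mem_range_self m) (mem_range_self k) (by linarith) (by linarith)
      linarith
  have hstrict := hpos 0 (0 + 1 + 1)
    (by simpa [add_assoc] using fin_one_add_one_ne_zero (by omega : 3 ≤ n))
    (by simp; omega)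
  have hD₀ : 0 < D := by
    have h := hmax 0 (0 + 1)
    refine lt_of_le_of_ne (by positivity) fun h₀ => ?_
    rw [← h₀] at h
    have h₁ : (p (0 + 1)).1 - (p 0).1 = 0 := by nlinarith
    have h₂ : (p (0 + 1)).2 - (p 0).2 = 0 := by nlinarith
    simp only [Cross, h₁, h₂] at hstrict
    simp at hstrict
  set q₀ : Fin n → ℝ × ℝ := fun i =>
    ((b.1 - a.1) * ((p i).1 - a.1) + (b.2 - a.2) * ((p i).2 - a.2), ε * Cross a b (p i)) with hq₀
  have hcross₀ : ∀ i j k, Cross (q₀ i) (q₀ j) (q₀ k) = D * (ε * Cross (p i) (p j) (p k)) := by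
    intro i j k
    simp only [hq₀, hD, Cross]
    ring
  have hH₀ : 0 < H := by
    have hflat : ∀ i, ε * Cross a b (p m) ≤ (q₀ i).2 ∧ (q₀ i).2 ≤ ε * Cross a b (p k) :=
      fun i => ⟨hm i, hk i⟩
    refine lt_of_le_of_ne (by linarith) fun h₀ => ?_
    have hc : ∀ i, (q₀ i).2 = 0 := fun i => by linarith [hflat i]
    have h := hcross₀ 0 (0 + 1) (0 + 1 + 1)
    have h' := mul_pos hD₀ hstrict
    rw [← h] at h'
    simp [Cross, hc] at h'
  set q : Fin n → ℝ × ℝ := fun i => ((q₀ i).1 / D, (q₀ i).2 / H) with hq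
  have hcross : ∀ i j k, Cross (q i) (q j) (q k) = ε * Cross (p i) (p j) (p k) / H := by
    intro i j k
    have h : Cross (q i) (q j) (q k) = Cross (q₀ i) (q₀ j) (q₀ k) / (D * H) := by
      simp only [hq, Cross]
      field_simp
    rw [h, hcross₀]
    field_simp
  have hqpos : ∀ i j : Fin n, j ≠ i → j ≠ i + 1 → 0 < Cross (q i) (q (i + 1)) (q j) := by
    intro i j h₁ h₂
    rw [hcross]
    exact div_pos (hpos i j h₁ h₂) hH₀
  have hfst : ∀ i, (q i).1 ∈ Icc 0 (0 + 1) := by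
    intro i
    have h₁ := hmax i₀ i
    have h₂ := hmax i j₀
    refine ⟨div_nonneg ?_ hD₀.le, ?_⟩
    · nlinarith [sq_nonneg ((p i).1 - a.1), sq_nonneg ((p i).2 - a.2)]
    · rw [zero_add, div_le_one hD₀]
      nlinarith [sq_nonneg ((p i).1 - b.1), sq_nonneg ((p i).2 - b.2)]
  have hsnd : ∀ i, (q i).2 ∈
      Icc (ε * Cross a b (p m) / H) (ε * Cross a b (p m) / H + 1) := by
    intro i
    refine ⟨div_le_div_of_nonneg_right (hm i) hH₀.le, ?_⟩
    rw [div_add_one hH₀.ne', hH, add_sub_cancel]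
    exact div_le_div_of_nonneg_right (hk i) hH₀.le
  obtain ⟨i, hi⟩ := exists_cross_le_of_mem_unit_square (by omega) hqpos _ _ hfst hsnd
  refine ⟨i, (area_triangle_le _ _ _).trans ?_⟩
  have hear : |Cross (p (i - 1)) (p i) (p (i + 1))| ≤ 64 / (n : ℝ) ^ 3 * H := by
    have h := cross_prev_pos (by omega) hqpos i
    rw [hcross] at h hi
    rw [← one_mul |_|, ← hε, ← abs_mul, abs_of_pos ((div_pos_iff_of_pos_right hH₀).1 h)]
    exact (div_le_iff₀ hH₀).1 hi
  have hsin : 4 / (n : ℝ) ≤ Real.sin (2 * Real.pi / n) := by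
    have h := Real.mul_le_sin (x := 2 * Real.pi / n) (by positivity) ?_
    · refine le_trans (le_of_eq ?_) h
      field_simp
      norm_num
    · rw [div_le_div_iff₀ hn₀ two_pos]
      have : (4 : ℝ) ≤ n := by exact_mod_cast hn
      nlinarith [Real.pi_pos]
  have harea : 0 ≤ area (range p) := ENNReal.toReal_nonneg
  calc |Cross (p (i - 1)) (p i) (p (i + 1))| / 2
      ≤ 64 / (n : ℝ) ^ 3 * (2 * area (range p)) / 2 := by
        gcongr
        exact hear.trans (by gcongr)
    _ = 4 / (n : ℝ) * (4 / n) ^ 2 * area (range p) := by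
        field_simp
        ring
    _ ≤ _ := by gcongr
end

section
/- Let P be a convex n-gon and let m satisfy 3 ≤ m ≤ n. For every convex polygon Q with m vertices contained in the convex hull of P, there exists an m-element subset S of the vertices of P such that the area of the convex hull of S is at least the area of Q. (Thus in the definition of f_n(m) one may restrict the inscribed m-gons to those whose vertices are vertices of P.) -/
open MeasureTheory

theorem area_mono {S T : Set (ℝ × ℝ)} (hT : T.Finite) (h : S ⊆ T) : area S ≤ area T :=
  ENNReal.toReal_mono (hT.isCompact_convexHull (𝕜 := ℝ)).measure_lt_top.ne
    (measure_mono (convexHull_mono h))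

theorem Real.volume_le_of_subset_combo {A B F : Set ℝ} {l r : ℝ} (hl : 0 ≤ l) (hr : 0 ≤ r)
    (hA : IsCompact A) (hB : IsCompact B) (hA' : Convex ℝ A) (hB' : Convex ℝ B)
    (h : ∀ y ∈ F, ∃ a ∈ A, ∃ b ∈ B, y = l * a + r * b) :
    volume F ≤ ENNReal.ofReal l * volume A + ENNReal.ofReal r * volume B := by
  rcases F.eq_empty_or_nonempty with rfl | ⟨y, hy⟩
  · simp
  obtain ⟨a, ha, b, hb, -⟩ := h y hy
  have eA := eq_Icc_of_connected_compact ⟨⟨a, ha⟩, hA'.isPreconnected⟩ hA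
  have eB := eq_Icc_of_connected_compact ⟨⟨b, hb⟩, hB'.isPreconnected⟩ hB
  generalize sInf A = a₀ at eA
  generalize sSup A = a₁ at eA
  generalize sInf B = b₀ at eB
  generalize sSup B = b₁ at eB
  subst eA eB
  have hF : F ⊆ Set.Icc (l * a₀ + r * b₀) (l * a₁ + r * b₁) := by
    intro z hz
    obtain ⟨c, hc, d, hd, rfl⟩ := h z hz
    constructor
    · gcongr
      exacts [hc.1, hd.1]
    · gcongr
      exacts [hc.2, hd.2]
  have h₁ : 0 ≤ a₁ - a₀ := by linarith [ha.1, ha.2]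
  have h₂ : 0 ≤ b₁ - b₀ := by linarith [hb.1, hb.2]
  refine (measure_mono hF).trans (le_of_eq ?_)
  rw [Real.volume_Icc, Real.volume_Icc, Real.volume_Icc, ← ENNReal.ofReal_mul hl,
    ← ENNReal.ofReal_mul hr, ← ENNReal.ofReal_add (by positivity) (by positivity)]
  congr 1
  ring

theorem IsCompact.prodMk_preimage {C : Set (ℝ × ℝ)} (hC : IsCompact C) (u : ℝ) :
    IsCompact (Prod.mk u ⁻¹' C) :=
  (hC.image continuous_snd).of_isClosed_subset
    (hC.isClosed.preimage (Continuous.prodMk_right u)) fun y hy => ⟨(u, y), hy, rfl⟩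

theorem Convex.prodMk_preimage {C : Set (ℝ × ℝ)} (hC : Convex ℝ C) (u : ℝ) :
    Convex ℝ (Prod.mk u ⁻¹' C) := by
  intro y hy z hz a b ha hb hab
  have h := hC hy hz ha hb hab
  simpa [← add_mul, hab] using h

/-- Moving one point along a vertical line, the area of the convex hull is a convex function. -/
theorem volume_convexHull_insert_vertical {T : Set (ℝ × ℝ)} (hT : T.Finite) (hne : T.Nonempty)
    (c s t : ℝ) {l r : ℝ} (hl : 0 ≤ l) (hr : 0 ≤ r) (hlr : l + r = 1) :
    volume (convexHull ℝ (insert (c, l * s + r * t) T)) ≤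
      ENNReal.ofReal l * volume (convexHull ℝ (insert (c, s) T)) +
        ENNReal.ofReal r * volume (convexHull ℝ (insert (c, t) T)) := by
  have cpt (x : ℝ × ℝ) : IsCompact (convexHull ℝ (insert x T)) :=
    (hT.insert x).isCompact_convexHull (𝕜 := ℝ)
  have meas (x : ℝ × ℝ) := (cpt x).measurableSet
  rw [Measure.volume_eq_prod, Measure.prod_apply (meas _), Measure.prod_apply (meas _),
    Measure.prod_apply (meas _), ← lintegral_const_mul _ (measurable_measure_prodMk_left (meas _)),
    ← lintegral_const_mul _ (measurable_measure_prodMk_left (meas _)),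
    ← lintegral_add_left ((measurable_measure_prodMk_left (meas _)).const_mul _)]
  refine lintegral_mono fun u => Real.volume_le_of_subset_combo hl hr
    ((cpt _).prodMk_preimage u) ((cpt _).prodMk_preimage u)
    ((convex_convexHull ℝ _).prodMk_preimage u) ((convex_convexHull ℝ _).prodMk_preimage u) ?_
  intro y hy
  simp only [Set.mem_preimage, convexHull_insert hne, mem_convexJoin, Set.mem_singleton_iff,
    exists_eq_left] at hy ⊢
  obtain ⟨⟨k₁, k₂⟩, hk, a, b, ha, hb, hab, h⟩ := hy
  simp only [Prod.smul_mk, Prod.mk_add_mk, Prod.mk.injEq, smul_eq_mul] at h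
  refine ⟨a * s + b * k₂, ⟨(k₁, k₂), hk, a, b, ha, hb, hab, by simp [h.1]⟩,
    a * t + b * k₂, ⟨(k₁, k₂), hk, a, b, ha, hb, hab, by simp [h.1]⟩, ?_⟩
  rw [← h.2]
  linear_combination (-(b * k₂)) * hlr

/-- The area of the convex hull is a convex function of any one of the points. -/
theorem convexOn_area_insert {T : Set (ℝ × ℝ)} (hT : T.Finite) (hne : T.Nonempty) :
    ConvexOn ℝ Set.univ fun x => area (insert x T) := by
  refine ⟨convex_univ, fun x _ y _ l r hl hr hlr => ?_⟩
  have fin (z : ℝ × ℝ) : volume (convexHull ℝ (insert z T)) ≠ ⊤ :=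
    ((hT.insert z).isCompact_convexHull (𝕜 := ℝ)).measure_lt_top.ne
  suffices h : volume (convexHull ℝ (insert (l • x + r • y) T)) ≤
      ENNReal.ofReal l * volume (convexHull ℝ (insert x T)) +
        ENNReal.ofReal r * volume (convexHull ℝ (insert y T)) by
    have h' := ENNReal.toReal_mono (by finiteness [fin x, fin y]) h
    rwa [ENNReal.toReal_add (by finiteness [fin x]) (by finiteness [fin y]),
      ENNReal.toReal_mul, ENNReal.toReal_mul, ENNReal.toReal_ofReal hl,
      ENNReal.toReal_ofReal hr] at h'
  rcases eq_or_ne x y with rfl | hxy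
  · rw [← add_smul, hlr, one_smul, ← add_mul, ← ENNReal.ofReal_add hl hr, hlr]
    simp
  obtain ⟨A, hA⟩ := SeparatingDual.exists_continuousLinearEquiv_apply_eq (R := ℝ)
    (x := ((0, 1) : ℝ × ℝ)) (y := y - x) (by simp) (sub_ne_zero.2 hxy.symm)
  have key (z : ℝ × ℝ) : volume (convexHull ℝ (insert (A z) T)) =
      ENNReal.ofReal |LinearMap.det (A : (ℝ × ℝ) →ₗ[ℝ] ℝ × ℝ)| *
        volume (convexHull ℝ (insert z (A.symm '' T))) := by
    rw [← Measure.addHaar_image_linearMap, LinearMap.image_convexHull, Set.image_insert_eq,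
      Set.image_image]
    simp
  obtain ⟨⟨c, s⟩, hx⟩ := A.surjective x
  have hy : A (c, s + 1) = y := by
    have : ((c, s + 1) : ℝ × ℝ) = (c, s) + (0, 1) := by simp
    rw [this, map_add, hA, hx]
    abel
  have hxy' : A (c, l * s + r * (s + 1)) = l • x + r • y := by
    rw [← hx, ← hy, ← map_smul, ← map_smul, ← map_add]
    simp [← add_mul, hlr]
  rw [← hxy', ← hx, ← hy, key, key, key]
  calc _ ≤ _ := mul_le_mul_right (volume_convexHull_insert_vertical (hT.image A.symm)
        (hne.image A.symm) c s (s + 1) hl hr hlr) _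
    _ = _ := by ring

theorem exists_vertices_area_ge {n m : ℕ} (hm : 2 ≤ m) (p : Fin n → ℝ × ℝ) (q : Fin m → ℝ × ℝ)
    (hsub : ∀ j, q j ∈ convexHull ℝ (Set.range p)) :
    ∃ f : Fin m → Fin n, area (Set.range q) ≤ area (Set.range (p ∘ f)) := by
  suffices H : ∀ J : Finset (Fin m), ∃ q' : Fin m → ℝ × ℝ, (∀ j ∈ J, q' j ∈ Set.range p) ∧
      (∀ j, q' j ∈ convexHull ℝ (Set.range p)) ∧ area (Set.range q) ≤ area (Set.range q') by
    obtain ⟨q', h, -, hle⟩ := H Finset.univ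
    choose f hf using fun j => h j (Finset.mem_univ j)
    exact ⟨f, by rwa [show p ∘ f = q' from funext hf]⟩
  intro J
  induction J using Finset.induction_on with
  | empty => exact ⟨q, by simp, hsub, le_rfl⟩
  | insert j J hj ih =>
    obtain ⟨q', hJ, hq', hle⟩ := ih
    have hrange (x : ℝ × ℝ) :
        Set.range (Function.update q' j x) = insert x (q' '' {j}ᶜ) := by
      rw [← Set.image_univ, ← Set.union_compl_self {j}, ← Set.insert_eq, Set.image_insert_eq,
        Function.update_self]
      congr 1
      exact Set.image_congr fun i hi => Function.update_of_ne hi _ _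
    have : Nontrivial (Fin m) := Fin.nontrivial_iff_two_le.2 hm
    have hne : (q' '' {j}ᶜ).Nonempty := (Set.nonempty_compl_of_nontrivial j).image q'
    obtain ⟨_, ⟨i, rfl⟩, hi⟩ := ((convexOn_area_insert (Set.toFinite _) hne).subset
      (Set.subset_univ _) (convex_convexHull ℝ _)).exists_ge_of_mem_convexHull
      (subset_convexHull ℝ (Set.range p)) (hq' j)
    refine ⟨Function.update q' j (p i), fun k hk => ?_, fun k => ?_, hle.trans ?_⟩
    · rcases eq_or_ne k j with rfl | hkj
      · simp
      · rw [Function.update_of_ne hkj]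
        exact hJ k ((Finset.mem_insert.1 hk).resolve_left hkj)
    · rcases eq_or_ne k j with rfl | hkj
      · simpa using subset_convexHull ℝ _ (Set.mem_range_self i)
      · rw [Function.update_of_ne hkj]
        exact hq' k
    · rw [hrange]
      rwa [← hrange, Function.update_eq_self] at hi

/-- For any convex `m`-gon `Q` contained in the convex hull of a convex `n`-gon `P`
(with `3 ≤ m ≤ n`), there is an `m`-element subset of the vertices of `P` whose
convex hull has area at least that of `Q`. -/
theorem inscribed_mgon_vertices_suffice
    (n m : ℕ) (hm : 3 ≤ m) (hmn : m ≤ n)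
    (p : Fin n → ℝ × ℝ) (hp : StrictConvexPos p)
    (q : Fin m → ℝ × ℝ) (hq : StrictConvexPos q)
    (hsub : ∀ j : Fin m, q j ∈ convexHull ℝ (Set.range p)) :
    ∃ s : Finset (Fin n), s.card = m ∧
      area (Set.range q) ≤ area (p '' ↑s) := by
  obtain ⟨f, hf⟩ := exists_vertices_area_ge (by omega) p q hsub
  obtain ⟨s, hfs, hs⟩ := Finset.exists_superset_card_eq (s := Finset.univ.image f)
    (Finset.card_image_le.trans_eq (Finset.card_fin m)) (by simpa using hmn)
  refine ⟨s, hs, hf.trans (area_mono (Set.toFinite _) ?_)⟩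
  rintro _ ⟨j, rfl⟩
  exact ⟨f j, hfs (Finset.mem_image_of_mem f (Finset.mem_univ j)), rfl⟩
end
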